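/- arXiv:1310.6684 — 2 statements merged into one kernel-verified Lean document; each statement's English description precedes it below -/
import Mathlib

section
/- Let F be an infinite field, n ≥ 1, and let m₁,…,mₙ be positive integers. Let Δ ⊂ ℝ² be a convex lattice polygon with minimal lattice width ω(Δ) ≥ max(m₁,…,mₙ). Suppose that for every choice of n points p₁,…,pₙ ∈ F² there exists a nonzero polynomial C ∈ F[x,y] whose Newton polygon equals Δ and such that μ_{pᵢ}(C) ≥ mᵢ for every i = 1,…,n. Then area(Δ) ≥ ½·Σᵢ₌₁ⁿ mᵢ² − ½·max{ Σᵢ₌₁ⁿ sᵢ² : s₁,…,sₙ ∈ ℤ, 0 ≤ sᵢ ≤ mᵢ for all i, and Σᵢ₌₁ⁿ sᵢ ≤ ω(Δ) }. -/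
open MvPolynomial

/-- The lattice width of a subset of `ℝ²` in the direction `u ∈ ℤ²`. -/
noncomputable def latticeWidth (u : ℤ × ℤ) (Δ : Set (ℝ × ℝ)) : ℝ :=
  sSup { w : ℝ | ∃ x ∈ Δ, ∃ y ∈ Δ, w = u.1 * (x.1 - y.1) + u.2 * (x.2 - y.2) }

/-- The minimal lattice width: the infimum over all nonzero directions `u ∈ ℤ²`. -/
noncomputable def minLatticeWidth (Δ : Set (ℝ × ℝ)) : ℝ :=
  sInf { w : ℝ | ∃ u : ℤ × ℤ, u ≠ 0 ∧ w = latticeWidth u Δ }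

/-- A (two-dimensional) convex lattice polygon in `ℝ²`. -/
def IsLatticePolygon (Δ : Set (ℝ × ℝ)) : Prop :=
  (∃ A : Finset (ℤ × ℤ),
    Δ = convexHull ℝ ((fun p : ℤ × ℤ => ((p.1 : ℝ), (p.2 : ℝ))) '' ↑A)) ∧
  (interior Δ).Nonempty

/-- The Newton polygon of a polynomial in two variables. -/
noncomputable def newtonPolygon {K : Type*} [CommRing K] (f : MvPolynomial (Fin 2) K) :
    Set (ℝ × ℝ) :=
  convexHull ℝ ((fun d : Fin 2 →₀ ℕ => ((d 0 : ℝ), (d 1 : ℝ))) '' ↑f.support)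

/-- `μ_p(f) ≥ m` : the point `p` has multiplicity at least `m` on the curve `f = 0`. -/
def multAtLeast {K : Type*} [CommRing K] (p : K × K) (m : ℕ) (f : MvPolynomial (Fin 2) K) :
    Prop :=
  f ∈ (Ideal.span {X 0 - C p.1, X 1 - C p.2} : Ideal (MvPolynomial (Fin 2) K)) ^ m


theorem exists_supporting_chord {ι : Type*} (S : Finset ι) (c g : ι → ℝ) (x : ℝ)
    (hx : ∀ j ∈ S, c j ≠ x) (hl : ∃ p ∈ S, c p < x) (hr : ∃ q ∈ S, x < c q) :
    ∃ p ∈ S, ∃ q ∈ S, c p < x ∧ x < c q ∧ ∃ κ θ : ℝ, (∀ j ∈ S, g j ≤ κ + θ * c j) ∧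
      g p = κ + θ * c p ∧ g q = κ + θ * c q := by
  classical
  let L := S.filter (fun p => c p < x)
  let R := S.filter (fun p => x < c p)
  have hne : (L ×ˢ R).Nonempty := by
    obtain ⟨p, hp, hp'⟩ := hl
    obtain ⟨q, hq, hq'⟩ := hr
    exact ⟨(p, q), by simp [L, R, *]⟩
  obtain ⟨⟨p, q⟩, hpq, hmax⟩ := Finset.exists_max_image (L ×ˢ R)
    (fun y => ((c y.2 - x) * g y.1 + (x - c y.1) * g y.2) / (c y.2 - c y.1)) hne
  simp only [L, R, Finset.mem_product, Finset.mem_filter, and_imp, Prod.forall] at hpq hmax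
  obtain ⟨⟨hp, hpx⟩, hq, hqx⟩ := hpq
  have hd : 0 < c q - c p := by linarith
  refine ⟨p, hp, q, hq, hpx, hqx, g p - (g q - g p) / (c q - c p) * c p,
    (g q - g p) / (c q - c p), ?_, by ring, by field_simp; ring⟩
  intro j hj
  suffices h : g j * (c q - c p) ≤ g p * (c q - c p) + (g q - g p) * (c j - c p) by
    have h2 : g p - (g q - g p) / (c q - c p) * c p + (g q - g p) / (c q - c p) * c j
        = (g p * (c q - c p) + (g q - g p) * (c j - c p)) / (c q - c p) := by field_simp; ring
    rw [h2, le_div_iff₀ hd]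
    exact h
  rcases lt_or_gt_of_ne (hx j hj) with h | h
  · have := hmax j q hj h hq hqx
    rw [div_le_div_iff₀ (by linarith) hd] at this
    have h3 : 0 < c q - x := by linarith
    refine le_of_mul_le_mul_left ?_ h3
    nlinarith
  · have := hmax p j hp hpx hj h
    rw [div_le_div_iff₀ (by linarith) hd] at this
    have h3 : 0 < x - c p := by linarith
    refine le_of_mul_le_mul_left ?_ h3
    nlinarith

theorem natDegree_le_of_dvd_of_eval_zero_ne_zero {F : Type*} [Field F] {P D : Polynomial F}
    (hP : P ≠ 0) (hD : D ∣ P) (h0 : D.coeff 0 ≠ 0) :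
    P.natTrailingDegree + D.natDegree ≤ P.natDegree := by
  obtain ⟨Q, rfl⟩ := hD
  have hD0 : D ≠ 0 := left_ne_zero_of_mul hP
  have hQ0 : Q ≠ 0 := right_ne_zero_of_mul hP
  rw [Polynomial.natTrailingDegree_mul hD0 hQ0, Polynomial.natDegree_mul hD0 hQ0,
    Polynomial.natTrailingDegree_eq_zero.2 (Or.inr h0)]
  have := Q.natTrailingDegree_le_natDegree
  omega

theorem exists_kernel_vector {F ι ρ : Type*} [Field F] [Infinite F] [Fintype ι] [Fintype ρ]
    (M : ρ → ι → Polynomial F) (P : Set ι)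
    (h : ∀ τ : F, τ ≠ 0 → ∃ c : ι → F, (∀ r, ∑ v, (M r v).eval τ * c v = 0) ∧ ∃ v ∈ P, c v ≠ 0) :
    ∃ c : ι → Polynomial F, (∀ r, ∑ v, M r v * c v = 0) ∧ ∃ v ∈ P, c v ≠ 0 := by
  classical
  let K := FractionRing (Polynomial F)
  let A : Matrix ρ ι K := fun r v => algebraMap _ K (M r v)
  by_cases hker : ∃ c : ι → K, A.mulVec c = 0 ∧ ∃ v ∈ P, c v ≠ 0
  · obtain ⟨c, hc, v, hv, hcv⟩ := hker
    obtain ⟨b, hb⟩ := IsLocalization.exist_integer_multiples_of_finite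
      (nonZeroDivisors (Polynomial F)) c
    choose c' hc' using hb
    have hinj : Function.Injective (algebraMap (Polynomial F) K) := IsFractionRing.injective _ _
    refine ⟨c', fun r => hinj ?_, v, hv, fun h0 => ?_⟩
    · have h1 := congrFun hc r
      simp only [Matrix.mulVec, dotProduct, A, Pi.zero_apply] at h1
      simp only [map_sum, map_mul, hc', map_zero, Algebra.smul_def]
      simp only [mul_left_comm _ (algebraMap (Polynomial F) K b), ← Finset.mul_sum, h1, mul_zero]
    · have h1 := hc' v
      rw [h0, map_zero, Algebra.smul_def, eq_comm, mul_eq_zero] at h1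
      rcases h1 with h1 | h1
      · exact nonZeroDivisors.coe_ne_zero b (hinj (by rw [h1, map_zero]))
      · exact hcv h1
  · exfalso
    push Not at hker
    have key : ∀ v ∈ P, ∃ D : Polynomial F, D ≠ 0 ∧ ∃ y : ρ → Polynomial F,
        ∀ v', ∑ r, y r * M r v' = if v' = v then D else 0 := by
      intro v hv
      have h1 : (LinearMap.proj v : (ι → K) →ₗ[K] K) ∈
          (LinearMap.ker A.mulVecLin).dualAnnihilator := by
        rw [Submodule.mem_dualAnnihilator]
        intro c hc
        exact hker c (by simpa using hc) v hv
      rw [← LinearMap.range_dualMap_eq_dualAnnihilator_ker] at h1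
      obtain ⟨φ, hφ⟩ := h1
      obtain ⟨b, hb⟩ := IsLocalization.exist_integer_multiples_of_finite
        (nonZeroDivisors (Polynomial F)) (fun r => φ (Pi.single r 1))
      choose y hy using hb
      have hinj : Function.Injective (algebraMap (Polynomial F) K) := IsFractionRing.injective _ _
      refine ⟨b, nonZeroDivisors.coe_ne_zero b, y, fun v' => hinj ?_⟩
      have h2 := LinearMap.congr_fun hφ (Pi.single v' 1)
      have h3 : A.mulVecLin (Pi.single v' 1) = ∑ r, A r v' • Pi.single r (1 : K) := by
        ext r
        simp [Finset.sum_apply, Pi.single_apply]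
      simp only [LinearMap.dualMap_apply, h3, map_sum, map_smul, LinearMap.proj_apply,
        Pi.single_apply,
        smul_eq_mul] at h2
      simp only [map_sum, map_mul, hy, Algebra.smul_def, mul_assoc, ← Finset.mul_sum]
      have h4 : ∑ r, φ (Pi.single r 1) * algebraMap (Polynomial F) K (M r v') =
          if v = v' then 1 else 0 := by
        rw [← h2]
        exact Finset.sum_congr rfl fun r _ => mul_comm _ _
      rw [h4]
      by_cases hvv : v' = v
      · simp [hvv]
      · simp [hvv, Ne.symm hvv]
    choose! D hD y hy using key
    let Q : Polynomial F := Polynomial.X * ∏ v : ι, if v ∈ P then D v else 1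
    have hQ : Q ≠ 0 := by
      refine mul_ne_zero Polynomial.X_ne_zero (Finset.prod_ne_zero_iff.2 fun v _ => ?_)
      split_ifs with hv
      · exact hD v hv
      · exact one_ne_zero
    obtain ⟨τ, hτ⟩ : ∃ τ, Q.eval τ ≠ 0 := by
      by_contra! hall
      exact hQ (Polynomial.funext fun τ => by simpa using hall τ)
    simp only [Q, Polynomial.eval_mul, Polynomial.eval_X, Polynomial.eval_prod, mul_ne_zero_iff,
      Finset.prod_ne_zero_iff] at hτ
    obtain ⟨c, hc, v, hv, hcv⟩ := h τ hτ.1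
    have h5 := hτ.2 v (Finset.mem_univ v)
    rw [if_pos hv] at h5
    have h6 : (D v).eval τ * c v = ∑ v', (∑ r, (y v r).eval τ * (M r v').eval τ) * c v' := by
      have : ∀ v', ∑ r, (y v r).eval τ * (M r v').eval τ =
          if v' = v then (D v).eval τ else 0 := by
        intro v'
        have := congrArg (Polynomial.eval τ) (hy v hv v')
        simp only [Polynomial.eval_finsetSum, Polynomial.eval_mul] at this
        rw [this]
        split_ifs <;> simp
      simp [this]
    have h7 : ∑ v', (∑ r, (y v r).eval τ * (M r v').eval τ) * c v' = 0 := by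
      simp only [Finset.sum_mul]
      rw [Finset.sum_comm]
      refine Finset.sum_eq_zero fun r _ => ?_
      simp only [mul_assoc, ← Finset.mul_sum, hc r, mul_zero]
    exact mul_ne_zero h5 hcv (h6.trans h7)

/-- On each unit interval `[z, z + 1)`, the affine function interpolating `n` between the
nodes `p z` and `q z`. -/
noncomputable def chordInterp (p q : ℤ → ℤ) (n : ℤ → ℝ) (x : ℝ) : ℝ :=
  ((q ⌊x⌋ - x) * n (p ⌊x⌋) + (x - p ⌊x⌋) * n (q ⌊x⌋)) / (q ⌊x⌋ - p ⌊x⌋)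

theorem measurable_chordInterp (p q : ℤ → ℤ) (n : ℤ → ℝ) : Measurable (chordInterp p q n) := by
  have h : ∀ f : ℤ → ℝ, Measurable (fun x : ℝ => f ⌊x⌋) := fun f =>
    (measurable_of_countable f).comp Int.measurable_floor
  exact ((((h fun z => q z).sub measurable_id).mul (h fun z => n (p z))).add
    ((measurable_id.sub (h fun z => p z)).mul (h fun z => n (q z)))).div
    ((h fun z => q z).sub (h fun z => p z))

theorem exists_chordInterp_eq {p q : ℤ → ℤ} {x : ℝ} (hp : p ⌊x⌋ ≤ ⌊x⌋) (hq : ⌊x⌋ + 1 ≤ q ⌊x⌋) :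
    ∃ w w' : ℝ, 0 ≤ w ∧ 0 ≤ w' ∧ w + w' = 1 ∧ w * p ⌊x⌋ + w' * q ⌊x⌋ = x ∧
      ∀ n : ℤ → ℝ, chordInterp p q n x = w * n (p ⌊x⌋) + w' * n (q ⌊x⌋) := by
  have h1 : (p ⌊x⌋ : ℝ) ≤ x := (Int.cast_le.2 hp).trans (Int.floor_le x)
  have h2 : x < q ⌊x⌋ := (Int.lt_floor_add_one x).trans_le (by exact_mod_cast hq)
  have h3 : (0 : ℝ) < q ⌊x⌋ - p ⌊x⌋ := by linarith
  refine ⟨(q ⌊x⌋ - x) / (q ⌊x⌋ - p ⌊x⌋), (x - p ⌊x⌋) / (q ⌊x⌋ - p ⌊x⌋),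
    div_nonneg (by linarith) h3.le, div_nonneg (by linarith) h3.le, ?_, ?_, fun n => ?_⟩
  · field_simp; ring
  · field_simp; ring
  · rw [chordInterp]; ring

theorem le_chordInterp {J : Finset ℤ} {Λ : Finset ℕ} {n : ℤ → ℕ} {G : ℤ → ℝ} {μ : ℕ → ℝ}
    {p q : ℤ → ℤ} {κ θ : ℤ → ℝ} {x h c t P Q : ℝ}
    (hn : ∀ j ∈ J, n j ∈ Λ ∧ G j ≤ μ (n j))
    (hp : p ⌊x⌋ ∈ J) (hq : q ⌊x⌋ ∈ J) (hpz : p ⌊x⌋ ≤ ⌊x⌋) (hqz : ⌊x⌋ + 1 ≤ q ⌊x⌋)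
    (hpe : G (p ⌊x⌋) = κ ⌊x⌋ + θ ⌊x⌋ * p ⌊x⌋) (hqe : G (q ⌊x⌋) = κ ⌊x⌋ + θ ⌊x⌋ * q ⌊x⌋)
    (ht : 0 < t) (hμ : ∀ k ∈ Λ, μ k ≤ c + t * k)
    (hP : c + t * h ≤ κ ⌊x⌋ + θ ⌊x⌋ * P) (hQ : c + t * h ≤ κ ⌊x⌋ + θ ⌊x⌋ * Q)
    (hPx : P ≤ x) (hxQ : x ≤ Q) :
    h ≤ chordInterp p q (fun j => n j) x := by
  obtain ⟨w, w', hw, hw', hww, hwx, hT⟩ := exists_chordInterp_eq hpz hqz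
  rw [hT]
  have h1 : c + t * h ≤ κ ⌊x⌋ + θ ⌊x⌋ * x := by
    rcases le_total 0 (θ ⌊x⌋) with h0 | h0
    · nlinarith
    · nlinarith
  have h2 := (hn _ hp).2.trans (hμ _ (hn _ hp).1)
  have h3 := (hn _ hq).2.trans (hμ _ (hn _ hq).1)
  rw [hpe] at h2
  rw [hqe] at h3
  have h4 : κ ⌊x⌋ + θ ⌊x⌋ * x = w * (κ ⌊x⌋ + θ ⌊x⌋ * p ⌊x⌋) + w' * (κ ⌊x⌋ + θ ⌊x⌋ * q ⌊x⌋) := by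
    linear_combination (-θ ⌊x⌋) * hwx - κ ⌊x⌋ * hww
  have h5 : c + t * h ≤ c + t * (w * n (p ⌊x⌋) + w' * n (q ⌊x⌋)) := by
    have e1 := mul_le_mul_of_nonneg_left h2 hw
    have e2 := mul_le_mul_of_nonneg_left h3 hw'
    have e3 : c = w * c + w' * c := by linear_combination (-c) * hww
    linarith
  exact le_of_mul_le_mul_left (by linarith) ht

theorem ofReal_sub_le_volume_chordInterp {J : Finset ℤ} {Λ : Finset ℕ} {n : ℤ → ℕ} {G : ℤ → ℝ}
    {μ : ℕ → ℝ} {p q : ℤ → ℤ} {κ θ : ℤ → ℝ} {A B : ℤ} {m : ℕ} {a b : ℕ → ℤ}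
    (hJ : ∀ j ∈ J, A ≤ j ∧ j ≤ B) (hm : (m : ℤ) ≤ B - A)
    (hn : ∀ j ∈ J, n j ∈ Λ ∧ G j ≤ μ (n j))
    (hpq : ∀ z, A ≤ z → z < B → p z ∈ J ∧ q z ∈ J ∧ p z ≤ z ∧ z + 1 ≤ q z ∧
      (∀ j ∈ J, G j ≤ κ z + θ z * j) ∧ G (p z) = κ z + θ z * p z ∧ G (q z) = κ z + θ z * q z)
    (hab : ∀ l ∈ Λ, a l ∈ J ∧ b l ∈ J ∧ (m : ℤ) - l ≤ b l - a l ∧ μ l ≤ G (a l) ∧ μ l ≤ G (b l))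
    {L : ℕ} (hL : L ∈ Λ) (hLmin : ∀ l ∈ Λ, l < L → μ l < μ L)
    {h : ℝ} (hh0 : 0 ≤ h) (hhL : h < L) :
    ENNReal.ofReal (m - h) ≤ MeasureTheory.volume
      {x : ℝ | x ∈ Set.Ico (A : ℝ) B ∧ h ≤ chordInterp p q (fun j => n j) x} := by
  have hfl : ∀ x ∈ Set.Ico (A : ℝ) B, A ≤ ⌊x⌋ ∧ ⌊x⌋ < B := fun x hx =>
    ⟨Int.le_floor.2 hx.1, Int.floor_lt.2 hx.2⟩
  suffices hs : ∃ P Q : ℝ, (A : ℝ) ≤ P ∧ Q ≤ B ∧ m - h ≤ Q - P ∧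
      ∀ x ∈ Set.Ico P Q, x ∈ Set.Ico (A : ℝ) B → h ≤ chordInterp p q (fun j => n j) x by
    obtain ⟨P, Q, hP, hQ, hPQ, hT⟩ := hs
    calc ENNReal.ofReal (m - h) ≤ ENNReal.ofReal (Q - P) := ENNReal.ofReal_le_ofReal hPQ
      _ = MeasureTheory.volume (Set.Ico P Q) := by rw [Real.volume_Ico]
      _ ≤ _ := by
        refine MeasureTheory.measure_mono fun x hx => ?_
        have : x ∈ Set.Ico (A : ℝ) B := ⟨hP.trans hx.1, hx.2.trans_le hQ⟩
        exact ⟨this, hT x hx this⟩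
  by_cases hlow : ∃ l ∈ Λ, (l : ℝ) ≤ h
  · obtain ⟨l₀, hl₀, hl₀h⟩ := hlow
    set z := ⌊h⌋₊ with hz
    have hzh : (z : ℝ) ≤ h := Nat.floor_le hh0
    have hhz : h < z + 1 := Nat.lt_floor_add_one h
    have hl₀z : l₀ ≤ z := Nat.le_floor hl₀h
    have hzL : z < L := (Nat.floor_lt hh0).2 hhL
    have half : ∀ k : ℕ, ((k : ℝ) < z + 1 / 2 → k ≤ z) ∧ ((z : ℝ) + 1 / 2 < k → z + 1 ≤ k) := by
      intro k
      constructor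
      · intro hk
        by_contra hc
        have : (z : ℝ) + 1 ≤ k := by exact_mod_cast not_le.1 hc
        linarith
      · intro hk
        by_contra hc
        have : (k : ℝ) ≤ z := by exact_mod_cast Nat.lt_succ_iff.1 (not_le.1 hc)
        linarith
    obtain ⟨l, hl, l', hl', hlz, hlz', c, t, hct, hcl, hcl'⟩ :=
      exists_supporting_chord Λ (fun k => (k : ℝ)) μ ((z : ℝ) + 1 / 2)
        (fun k _ hk => by
          rcases le_or_gt k z with hkz | hkz
          · have : (k : ℝ) ≤ z := by exact_mod_cast hkz
            linarith
          · have : (z : ℝ) + 1 ≤ k := by exact_mod_cast hkz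
            linarith)
        ⟨l₀, hl₀, by have : (l₀ : ℝ) ≤ z := by exact_mod_cast hl₀z
                     linarith⟩
        ⟨L, hL, by have : (z : ℝ) + 1 ≤ L := by exact_mod_cast hzL
                   linarith⟩
    have hlz1 := (half l).1 hlz
    have hlz1' := (half l').2 hlz'
    have hlh : (l : ℝ) ≤ h := le_trans (by exact_mod_cast hlz1) hzh
    have hlh' : h < l' := hhz.trans_le (by exact_mod_cast hlz1')
    have ht : 0 < t := by
      have h1 := hLmin l hl (by omega)
      have h2 := hct L hL
      have h3 : (l : ℝ) < L := by exact_mod_cast (by omega : l < L)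
      rw [hcl] at h1
      have h4 : 0 < t * (L - l) := by linarith
      exact pos_of_mul_pos_left h4 (by linarith)
    have hd : (0 : ℝ) < l' - l := by linarith
    obtain ⟨α, β, hα, hβ, hαβ, hαh⟩ : ∃ α β : ℝ, 0 ≤ α ∧ 0 ≤ β ∧ α + β = 1 ∧
        α * l + β * l' = h :=
      ⟨(l' - h) / (l' - l), (h - l) / (l' - l), div_nonneg (by linarith) hd.le,
        div_nonneg (by linarith) hd.le, by field_simp; ring, by field_simp; ring⟩
    obtain ⟨ha, hb, hw, hμa, hμb⟩ := hab l hl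
    obtain ⟨ha', hb', hw', hμa', hμb'⟩ := hab l' hl'
    have conv : ∀ u v y : ℝ, u ≤ y → v ≤ y → α * u + β * v ≤ y := by
      intro u v y hu hv
      have e : y = α * y + β * y := by linear_combination (-y) * hαβ
      have := mul_le_mul_of_nonneg_left hu hα
      have := mul_le_mul_of_nonneg_left hv hβ
      linarith
    have conv' : ∀ u v y : ℝ, y ≤ u → y ≤ v → y ≤ α * u + β * v := by
      intro u v y hu hv
      have e : y = α * y + β * y := by linear_combination (-y) * hαβ
      have := mul_le_mul_of_nonneg_left hu hα
      have := mul_le_mul_of_nonneg_left hv hβ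
      linarith
    refine ⟨α * a l + β * a l', α * b l + β * b l', ?_, ?_, ?_, ?_⟩
    · exact conv' _ _ _ (by exact_mod_cast (hJ _ ha).1) (by exact_mod_cast (hJ _ ha').1)
    · exact conv _ _ _ (by exact_mod_cast (hJ _ hb).2) (by exact_mod_cast (hJ _ hb').2)
    · have e1 : (m : ℝ) - l ≤ b l - a l := by exact_mod_cast hw
      have e2 : (m : ℝ) - l' ≤ b l' - a l' := by exact_mod_cast hw'
      have e3 := mul_le_mul_of_nonneg_left e1 hα
      have e4 := mul_le_mul_of_nonneg_left e2 hβ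
      have e5 : (m : ℝ) = α * m + β * m := by linear_combination (-(m : ℝ)) * hαβ
      linarith
    · intro x hx hxAB
      obtain ⟨hp, hq, hpz, hqz, hsup, hpe, hqe⟩ := hpq _ (hfl x hxAB).1 (hfl x hxAB).2
      have key : ∀ y y' : ℤ, y ∈ J → y' ∈ J → μ l ≤ G y → μ l' ≤ G y' →
          c + t * h ≤ κ ⌊x⌋ + θ ⌊x⌋ * (α * y + β * y') := by
        intro y y' hy hy' hμy hμy'
        have e1 := mul_le_mul_of_nonneg_left (hμy.trans (hsup y hy)) hα
        have e2 := mul_le_mul_of_nonneg_left (hμy'.trans (hsup y' hy')) hβ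
        rw [hcl] at e1
        rw [hcl'] at e2
        have e3 : c + t * h = α * (c + t * l) + β * (c + t * l') := by
          linear_combination (-c) * hαβ - t * hαh
        have e4 : κ ⌊x⌋ + θ ⌊x⌋ * (α * y + β * y') =
            α * (κ ⌊x⌋ + θ ⌊x⌋ * y) + β * (κ ⌊x⌋ + θ ⌊x⌋ * y') := by
          linear_combination (-κ ⌊x⌋) * hαβ
        linarith
      exact le_chordInterp hn hp hq hpz hqz hpe hqe ht hct (key _ _ ha ha' hμa hμa')
        (key _ _ hb hb' hμb hμb') hx.1 hx.2.le
  · push Not at hlow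
    refine ⟨A, B, le_rfl, le_rfl, ?_, ?_⟩
    · have : (m : ℝ) ≤ B - A := by exact_mod_cast hm
      linarith
    · intro x _ hxAB
      obtain ⟨hp, hq, hpz, hqz, -⟩ := hpq _ (hfl x hxAB).1 (hfl x hxAB).2
      obtain ⟨w, w', hw, hw', hww, -, hT⟩ := exists_chordInterp_eq hpz hqz
      rw [hT]
      have e1 := mul_le_mul_of_nonneg_left (hlow _ (hn _ hp).1).le hw
      have e2 := mul_le_mul_of_nonneg_left (hlow _ (hn _ hq).1).le hw'
      have e3 : h = w * h + w' * h := by linear_combination (-h) * hww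
      linarith

theorem ofReal_le_lintegral_chordInterp {J : Finset ℤ} {Λ : Finset ℕ} {n : ℤ → ℕ} {G : ℤ → ℝ}
    {μ : ℕ → ℝ} {p q : ℤ → ℤ} {κ θ : ℤ → ℝ} {A B : ℤ} {m : ℕ} {a b : ℕ → ℤ}
    (hJ : ∀ j ∈ J, A ≤ j ∧ j ≤ B) (hm : (m : ℤ) ≤ B - A)
    (hn : ∀ j ∈ J, n j ∈ Λ ∧ G j ≤ μ (n j))
    (hpq : ∀ z, A ≤ z → z < B → p z ∈ J ∧ q z ∈ J ∧ p z ≤ z ∧ z + 1 ≤ q z ∧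
      (∀ j ∈ J, G j ≤ κ z + θ z * j) ∧ G (p z) = κ z + θ z * p z ∧ G (q z) = κ z + θ z * q z)
    (hab : ∀ l ∈ Λ, a l ∈ J ∧ b l ∈ J ∧ (m : ℤ) - l ≤ b l - a l ∧ μ l ≤ G (a l) ∧ μ l ≤ G (b l))
    {L : ℕ} (hL : L ∈ Λ) (hLmin : ∀ l ∈ Λ, l < L → μ l < μ L) :
    ENNReal.ofReal ((1 / 2) * m ^ 2 - (1 / 2) * ((m - L : ℕ) : ℝ) ^ 2) ≤
      ∫⁻ x in Set.Ico (A : ℝ) B, ENNReal.ofReal (chordInterp p q (fun j => n j) x) := by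
  have hnn : 0 ≤ᵐ[MeasureTheory.volume.restrict (Set.Ico (A : ℝ) B)]
      chordInterp p q (fun j => (n j : ℝ)) := by
    refine MeasureTheory.ae_restrict_of_forall_mem measurableSet_Ico fun x hx => ?_
    obtain ⟨hp, hq, hpz, hqz, -⟩ := hpq _ (Int.le_floor.2 hx.1) (Int.floor_lt.2 hx.2)
    obtain ⟨w, w', hw, hw', -, -, hT⟩ := exists_chordInterp_eq hpz hqz
    rw [hT]
    simp only [Pi.zero_apply]
    positivity
  have hmeas := measurable_chordInterp p q (fun j => (n j : ℝ))
  rw [MeasureTheory.lintegral_eq_lintegral_meas_le _ hnn hmeas.aemeasurable]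
  set l := min L m with hl
  have hlm : l ≤ m := min_le_right _ _
  have hml : m - L = m - l := by omega
  have hlL : (l : ℝ) ≤ L := by exact_mod_cast min_le_left L m
  have hint : (1 / 2) * (m : ℝ) ^ 2 - (1 / 2) * ((m - L : ℕ) : ℝ) ^ 2 =
      ∫ h in Set.Ioc (0 : ℝ) l, ((m : ℝ) - h) := by
    rw [← intervalIntegral.integral_of_le (by positivity), intervalIntegral.integral_sub
      (by simp) (by simp), integral_id, intervalIntegral.integral_const, hml, Nat.cast_sub hlm]
    simp only [smul_eq_mul]
    ring
  have hnonneg : 0 ≤ᵐ[MeasureTheory.volume.restrict (Set.Ioc (0 : ℝ) l)] fun h => (m : ℝ) - h := by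
    refine MeasureTheory.ae_restrict_of_forall_mem measurableSet_Ioc fun h hh => ?_
    have : (l : ℝ) ≤ m := by exact_mod_cast hlm
    simp only [Pi.zero_apply]
    linarith [hh.2]
  rw [hint, MeasureTheory.ofReal_integral_eq_lintegral_ofReal ?_ hnonneg]
  · calc ∫⁻ h in Set.Ioc (0 : ℝ) l, ENNReal.ofReal (m - h)
        = ∫⁻ h in Set.Ioo (0 : ℝ) l, ENNReal.ofReal (m - h) := by
          rw [MeasureTheory.restrict_Ioo_eq_restrict_Ioc]
      _ ≤ ∫⁻ h in Set.Ioo (0 : ℝ) l, MeasureTheory.volume.restrict (Set.Ico (A : ℝ) B)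
            {x | h ≤ chordInterp p q (fun j => n j) x} := by
          refine MeasureTheory.setLIntegral_mono' measurableSet_Ioo fun h hh => ?_
          rw [MeasureTheory.Measure.restrict_apply (measurableSet_le measurable_const hmeas)]
          convert ofReal_sub_le_volume_chordInterp hJ hm hn hpq hab hL hLmin hh.1.le
            (hh.2.trans_le hlL) using 2
          ext x
          simp [and_comm]
      _ ≤ _ := MeasureTheory.lintegral_mono_set fun h hh => hh.1
  · exact ((continuous_const.sub continuous_id).integrableOn_Icc).mono_set Set.Ioc_subset_Icc_self

theorem coeff_X_add_C_pow_mul {F : Type*} [Field F] (ξ η : F) (j k a b : ℕ) :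
    (((X 0 + C ξ) ^ j * (X 1 + C η) ^ k : MvPolynomial (Fin 2) F)).coeff
      (Finsupp.single 0 a + Finsupp.single 1 b) =
      (j.choose a * ξ ^ (j - a)) * (k.choose b * η ^ (k - b)) := by
  classical
  have h : ∀ (i : Fin 2) (ζ : F) (d : ℕ), (X i + C ζ : MvPolynomial (Fin 2) F) ^ d =
      ∑ e ∈ Finset.range (d + 1), monomial (Finsupp.single i e) (d.choose e * ζ ^ (d - e)) := by
    intro i ζ d
    rw [add_pow]
    refine Finset.sum_congr rfl fun e _ => ?_
    rw [X_pow_eq_monomial, ← C_pow, ← map_natCast (C : F →+* MvPolynomial (Fin 2) F), mul_assoc,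
      ← C_mul, mul_comm, C_mul_monomial, mul_one, mul_comm]
  have hinj : ∀ a' b' : ℕ, (Finsupp.single 0 a' + Finsupp.single 1 b' : Fin 2 →₀ ℕ) =
      Finsupp.single 0 a + Finsupp.single 1 b ↔ a' = a ∧ b' = b := by
    intro a' b'
    constructor
    · intro h
      have h0 := DFunLike.congr_fun h 0
      have h1 := DFunLike.congr_fun h 1
      simp at h0 h1
      exact ⟨h0, h1⟩
    · rintro ⟨rfl, rfl⟩; rfl
  rw [h, h, Finset.sum_mul_sum, coeff_sum]
  simp only [coeff_sum, monomial_mul, coeff_monomial, hinj]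
  simp only [ite_and, Finset.sum_ite_irrel, Finset.sum_ite_eq', Finset.sum_const_zero,
    Finset.mem_range]
  by_cases ha : a < j + 1
  · by_cases hb : b < k + 1
    · simp [ha, hb]
    · simp [ha, hb, Nat.choose_eq_zero_of_lt (show k < b by omega)]
  · simp [ha, Nat.choose_eq_zero_of_lt (show j < a by omega)]

theorem monomial_substitution {G : Type*} [CommGroup G] (U W : G) (u w : ℤ × ℤ) (N N' : ℤ)
    (d e : ℕ) {j k : ℕ} (hj : (j : ℤ) = u.1 * d + u.2 * e + N)
    (hk : (k : ℤ) = w.1 * d + w.2 * e + N') :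
    U ^ j * W ^ k =
      U ^ N * W ^ N' * ((U ^ u.1 * W ^ w.1) ^ d * (U ^ u.2 * W ^ w.2) ^ e) := by
  rw [← zpow_natCast U, ← zpow_natCast W, hj, hk, mul_pow, mul_pow]
  simp only [← zpow_natCast, ← zpow_mul, zpow_add]
  simp only [mul_assoc, mul_left_comm, mul_comm]

/-- The monomial substitution `x = X ^ u.1 * Y ^ w.1`, `y = X ^ u.2 * Y ^ w.2` preserves
multiplicities at points of the torus. -/
theorem sum_choose_eq_zero_of_multAtLeast {F : Type*} [Field F] {ξ η : F} (hξ : ξ ≠ 0)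
    (hη : η ≠ 0) (u w : ℤ × ℤ) (N N' : ℤ) {m : ℕ} {f : MvPolynomial (Fin 2) F}
    (hf : multAtLeast (ξ ^ u.1 * η ^ w.1, ξ ^ u.2 * η ^ w.2) m f) (j k : (Fin 2 →₀ ℕ) → ℕ)
    (hj : ∀ v ∈ f.support, (j v : ℤ) = u.1 * v 0 + u.2 * v 1 + N)
    (hk : ∀ v ∈ f.support, (k v : ℤ) = w.1 * v 0 + w.2 * v 1 + N')
    {a b : ℕ} (hab : a + b < m) :
    ∑ v ∈ f.support, f.coeff v * (((j v).choose a * ξ ^ (j v - a)) *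
      ((k v).choose b * η ^ (k v - b))) = 0 := by
  classical
  let I := idealOfVars (Fin 2) F
  let B := MvPolynomial (Fin 2) F ⧸ I ^ m
  let π : MvPolynomial (Fin 2) F →+* B := Ideal.Quotient.mk (I ^ m)
  have hm : m ≠ 0 := by omega
  have hX : ∀ i, (X i : MvPolynomial (Fin 2) F) ∈ I := fun i =>
    Ideal.subset_span (Set.mem_range_self i)
  have hunit : ∀ (i : Fin 2) (ζ : F), ζ ≠ 0 → IsUnit (π (X i + C ζ)) := by
    intro i ζ hζ
    rw [map_add, add_comm]
    refine IsNilpotent.isUnit_add_left_of_commute ?_ ?_ (Commute.all _ _)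
    · refine ⟨m, ?_⟩
      rw [← map_pow]
      exact Ideal.Quotient.eq_zero_iff_mem.2 (Ideal.pow_mem_pow (hX i) m)
    · exact (hζ.isUnit.map C).map π
  obtain ⟨U, hU⟩ := hunit 0 ξ hξ
  obtain ⟨W, hW⟩ := hunit 1 η hη
  let ε : B →+* F := Ideal.Quotient.lift (I ^ m) constantCoeff (by
    intro g hg
    have h1 : g ∈ I := Ideal.pow_le_self hm hg
    have h2 : I ≤ RingHom.ker (constantCoeff : MvPolynomial (Fin 2) F →+* F) := by
      rw [Ideal.span_le]
      rintro _ ⟨i, rfl⟩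
      simp
    exact h2 h1)
  have hεπ : ∀ g, ε (π g) = constantCoeff g := fun g => Ideal.Quotient.lift_mk _ _ _
  have hεU : Units.map (ε : B →* F) U = Units.mk0 ξ hξ := by
    ext
    simp [hU, hεπ]
  have hεW : Units.map (ε : B →* F) W = Units.mk0 η hη := by
    ext
    simp [hW, hεπ]
  let φ : MvPolynomial (Fin 2) F →+* B := eval₂Hom (π.comp C)
    ![((U ^ u.1 * W ^ w.1 : Bˣ) : B), ((U ^ u.2 * W ^ w.2 : Bˣ) : B)]
  have hker : ∀ y : B, ε y = 0 → y ∈ I.map π := by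
    intro y hy
    obtain ⟨g, rfl⟩ := Ideal.Quotient.mk_surjective y
    refine Ideal.mem_map_of_mem _ ?_
    have h1 : constantCoeff g = 0 := by rw [← hεπ]; exact hy
    have := (mem_pow_idealOfVars_iff' 1 g).2 (fun x hx => by
      have hx0 : x = 0 := by
        rw [← Finsupp.degree_eq_zero_iff]; omega
      rw [hx0]; exact h1)
    rwa [pow_one] at this
  have hεunit : ∀ s t : ℤ, ε ((U ^ s * W ^ t : Bˣ) : B) = ξ ^ s * η ^ t := by
    intro s t
    have : ε ((U ^ s * W ^ t : Bˣ) : B) = ((Units.map (ε : B →* F) (U ^ s * W ^ t) : Fˣ) : F) := rfl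
    rw [this, map_mul, map_zpow, map_zpow, hεU, hεW]
    simp
  have hφf : φ f = 0 := by
    have h1 : (Ideal.span {X 0 - C (ξ ^ u.1 * η ^ w.1), X 1 - C (ξ ^ u.2 * η ^ w.2)} :
        Ideal (MvPolynomial (Fin 2) F)) ≤ (I.map π).comap φ := by
      rw [Ideal.span_le]
      rintro g (rfl | rfl)
      · have h1 := hεunit u.1 w.1
        rw [Units.val_mul, map_mul] at h1
        exact hker _ (by simp [φ, hεπ, h1])
      · have h1 := hεunit u.2 w.2
        rw [Units.val_mul, map_mul] at h1
        exact hker _ (by simp [φ, hεπ, h1])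
    have h2 : φ f ∈ (I.map π) ^ m :=
      Ideal.le_comap_pow φ m (Ideal.pow_right_mono h1 m hf)
    rw [← Ideal.map_pow, Ideal.map_quotient_self] at h2
    exact h2
  let G : MvPolynomial (Fin 2) F :=
    ∑ v ∈ f.support, C (f.coeff v) * ((X 0 + C ξ) ^ j v * (X 1 + C η) ^ k v)
  have hG : π G = ((U ^ N * W ^ N' : Bˣ) : B) * φ f := by
    have h1 : φ f = ∑ v ∈ f.support, π (C (f.coeff v)) *
        (((U ^ u.1 * W ^ w.1) ^ v 0 * (U ^ u.2 * W ^ w.2) ^ v 1 : Bˣ) : B) := by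
      rw [coe_eval₂Hom, eval₂_eq']
      simp
    rw [h1, Finset.mul_sum, map_sum]
    refine Finset.sum_congr rfl fun v hv => ?_
    rw [map_mul, map_mul, map_pow, map_pow, ← hU, ← hW, ← Units.val_pow_eq_pow_val,
      ← Units.val_pow_eq_pow_val, ← Units.val_mul, mul_left_comm, ← Units.val_mul]
    congr 2
    exact monomial_substitution U W u w N N' (v 0) (v 1) (hj v hv) (hk v hv)
  have hGI : G ∈ I ^ m := by
    refine Ideal.Quotient.eq_zero_iff_mem.1 ?_
    change π G = 0
    rw [hG, hφf, mul_zero]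
  have h0 := (mem_pow_idealOfVars_iff' m G).1 hGI (Finsupp.single 0 a + Finsupp.single 1 b)
    (by simpa [map_add] using hab)
  simpa only [G, coeff_sum, coeff_C_mul, coeff_X_add_C_pow_mul] using h0

/-- The coefficient of `t ^ d` in `∑ j, (∑ e, D_l (f j e)(η) t ^ e) (t ^ i X) ^ j`, where `D_l` is
the `l`-th Hasse derivative. -/
noncomputable def hasseRow {F : Type*} [Field F] (f : ℕ → ℕ → Polynomial F) (K : ℕ) (η : F)
    (i l d : ℕ) : Polynomial F :=
  ∑ j ∈ Finset.range K, Polynomial.monomial j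
    (if i * j ≤ d then (Polynomial.hasseDeriv l (f j (d - i * j))).eval η else 0)

theorem coeff_hasseRow {F : Type*} [Field F] (f : ℕ → ℕ → Polynomial F) (K : ℕ) (η : F)
    (i l d j : ℕ) :
    (hasseRow f K η i l d).coeff j = if j < K ∧ i * j ≤ d then
      (Polynomial.hasseDeriv l (f j (d - i * j))).eval η else 0 := by
  simp only [hasseRow, Polynomial.finsetSum_coeff, Polynomial.coeff_monomial,
    Finset.sum_ite_eq', Finset.mem_range]
  split_ifs <;> simp_all

theorem X_sub_one_pow_dvd_hasseRow {F : Type*} [Field F] {f : ℕ → ℕ → Polynomial F} {K : ℕ}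
    {η : F} {i l d k : ℕ}
    (h : ∀ a, a < k → ∑ j ∈ Finset.range K, (j.choose a : F) *
      (if i * j ≤ d then (Polynomial.hasseDeriv l (f j (d - i * j))).eval η else 0) = 0) :
    (Polynomial.X - Polynomial.C 1) ^ k ∣ hasseRow f K η i l d := by
  have h2 : Polynomial.X ^ k ∣ Polynomial.taylor 1 (hasseRow f K η i l d) := by
    rw [Polynomial.X_pow_dvd_iff]
    intro a ha
    rw [Polynomial.taylor_coeff, hasseRow, map_sum, Polynomial.eval_finsetSum]
    refine Eq.trans (Finset.sum_congr rfl fun j _ => ?_) (h a ha)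
    rw [Polynomial.hasseDeriv_monomial, Polynomial.eval_monomial]
    simp
  obtain ⟨q, hq⟩ := h2
  refine ⟨Polynomial.taylor (-1) q, ?_⟩
  have := congrArg (Polynomial.taylor (-1)) hq
  rw [Polynomial.taylor_taylor] at this
  simp only [Polynomial.taylor_mul, Polynomial.taylor_pow, Polynomial.taylor_X] at this
  simpa [sub_eq_add_neg] using this

theorem natTrailingDegree_add_le_natDegree_hasseRow {F : Type*} [Field F]
    {f : ℕ → ℕ → Polynomial F} {K : ℕ} {η : F} {i l d k : ℕ}
    (h : ∀ a, a < k → ∑ j ∈ Finset.range K, (j.choose a : F) *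
      (if i * j ≤ d then (Polynomial.hasseDeriv l (f j (d - i * j))).eval η else 0) = 0)
    (h0 : hasseRow f K η i l d ≠ 0) :
    (hasseRow f K η i l d).natTrailingDegree + k ≤ (hasseRow f K η i l d).natDegree := by
  have := natDegree_le_of_dvd_of_eval_zero_ne_zero h0 (X_sub_one_pow_dvd_hasseRow h) (by
    rw [Polynomial.coeff_zero_eq_eval_zero]; simp)
  rwa [Polynomial.natDegree_pow, Polynomial.natDegree_X_sub_C, mul_one] at this

theorem hasseDeriv_rootMultiplicity_eval_ne_zero {F : Type*} [Field F] {f : Polynomial F}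
    (hf : f ≠ 0) (η : F) :
    (Polynomial.hasseDeriv (f.rootMultiplicity η) f).eval η ≠ 0 := by
  rw [← Polynomial.taylor_coeff, Polynomial.rootMultiplicity_eq_natTrailingDegree,
    ← Polynomial.taylor_apply]
  exact Polynomial.trailingCoeff_nonzero_iff_nonzero.2 fun h0 =>
    hf ((Polynomial.taylor_injective η) (by simpa using h0))

/-- The combinatorial shadow of a vanishing condition on the leading `t`-parts of the columns. -/
theorem exists_row_data {F : Type*} [Field F] {f : ℕ → ℕ → Polynomial F} {K : ℕ} {η : F}
    {i m : ℕ} {J : Finset ℕ} {g : ℕ → ℕ} (hJ : ∀ j, j ∈ J ↔ j < K ∧ ∃ e, f j e ≠ 0)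
    (hg : ∀ j ∈ J, f j (g j) ≠ 0 ∧ ∀ e, f j e ≠ 0 → e ≤ g j)
    (h : ∀ a b, a + b < m → ∀ d, ∑ j ∈ Finset.range K, (j.choose a : F) *
      (if i * j ≤ d then (Polynomial.hasseDeriv b (f j (d - i * j))).eval η else 0) = 0) :
    ∃ μ a b : ℕ → ℕ, (∀ j ∈ J, g j + i * j ≤ μ ((f j (g j)).rootMultiplicity η)) ∧
      ∀ l ∈ J.image fun j => (f j (g j)).rootMultiplicity η,
        a l ∈ J ∧ b l ∈ J ∧ a l ≤ b l ∧ m + a l ≤ l + b l ∧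
        μ l ≤ g (a l) + i * a l ∧ μ l ≤ g (b l) + i * b l := by
  have coeff_ne : ∀ l d j, (hasseRow f K η i l d).coeff j ≠ 0 → j ∈ J ∧ d ≤ g j + i * j := by
    intro l d j hne
    rw [coeff_hasseRow] at hne
    split_ifs at hne with hc
    · have hf : f j (d - i * j) ≠ 0 := fun h0 => hne (by simp [h0])
      have hj : j ∈ J := (hJ j).2 ⟨hc.1, _, hf⟩
      have := (hg j hj).2 _ hf
      exact ⟨hj, by omega⟩
    · exact absurd rfl hne
  have row_ne : ∀ j ∈ J,
      hasseRow f K η i ((f j (g j)).rootMultiplicity η) (g j + i * j) ≠ 0 := by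
    intro j hj h0
    have := congrArg (fun P => Polynomial.coeff P j) h0
    simp only [coeff_hasseRow, Polynomial.coeff_zero] at this
    rw [if_pos ⟨((hJ j).1 hj).1, by omega⟩, Nat.add_sub_cancel] at this
    exact hasseDeriv_rootMultiplicity_eval_ne_zero (hg j hj).1 η this
  have key : ∀ l ∈ J.image fun j => (f j (g j)).rootMultiplicity η,
      ∃ d, hasseRow f K η i l d ≠ 0 ∧ ∀ d', hasseRow f K η i l d' ≠ 0 → d' ≤ d := by
    intro l hl
    obtain ⟨j, hj, rfl⟩ := Finset.mem_image.1 hl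
    have hbdd : BddAbove {d | hasseRow f K η i ((f j (g j)).rootMultiplicity η) d ≠ 0} := by
      refine ⟨∑ j ∈ J, (g j + i * j), fun d hd => ?_⟩
      obtain ⟨j', hj'⟩ : ∃ j', (hasseRow f K η i
          ((f j (g j)).rootMultiplicity η) d).coeff j' ≠ 0 := by
        by_contra! hcon
        exact hd (Polynomial.ext fun j' => by simpa using hcon j')
      obtain ⟨h1, h2⟩ := coeff_ne _ _ _ hj'
      exact h2.trans (Finset.single_le_sum (f := fun j => g j + i * j)
        (fun _ _ => Nat.zero_le _) h1)
    exact ⟨_, Nat.sSup_mem ⟨_, row_ne j hj⟩ hbdd, fun d' hd' => le_csSup hbdd hd'⟩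
  choose! μ hμ using key
  refine ⟨μ, fun l => (hasseRow f K η i l (μ l)).natTrailingDegree,
    fun l => (hasseRow f K η i l (μ l)).natDegree,
    fun j hj => (hμ _ (Finset.mem_image_of_mem _ hj)).2 _ (row_ne j hj), fun l hl => ?_⟩
  have h0 := (hμ l hl).1
  obtain ⟨ha, ha'⟩ := coeff_ne l (μ l) _ (Polynomial.trailingCoeff_nonzero_iff_nonzero.2 h0)
  obtain ⟨hb, hb'⟩ := coeff_ne l (μ l) _ (Polynomial.leadingCoeff_ne_zero.2 h0)
  have hd := natTrailingDegree_add_le_natDegree_hasseRow (k := m - l)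
    (fun a ha => h a l (by omega) (μ l)) h0
  exact ⟨ha, hb, by dsimp only; omega, by dsimp only; omega, ha', hb'⟩

theorem sum_sub_add_le_of_pairwise_le {n A B : ℕ} (hAB : A ≤ B) {a b : Fin n → ℕ}
    (hA : ∀ i, A ≤ a i) (hB : ∀ i, b i ≤ B) (hab : ∀ i i', i < i' → b i ≤ a i') :
    ∑ i, (b i - a i) + A ≤ B := by
  have hdisj : ((Finset.univ : Finset (Fin n)) : Set (Fin n)).PairwiseDisjoint
      fun i => Finset.Ico (a i) (b i) := by
    intro i _ i' _ hne
    refine Finset.disjoint_left.2 fun x hx hx' => ?_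
    rw [Finset.mem_Ico] at hx hx'
    rcases lt_or_gt_of_ne hne with h | h
    · have := hab _ _ h
      omega
    · have := hab _ _ h
      omega
  have hsub : Finset.univ.biUnion (fun i => Finset.Ico (a i) (b i)) ⊆ Finset.Ico A B := by
    refine Finset.biUnion_subset.2 fun i _ => Finset.Ico_subset_Ico (hA i) (hB i)
  have := Finset.card_le_card hsub
  rw [Finset.card_biUnion hdisj] at this
  simp only [Nat.card_Ico] at this
  omega

theorem sum_lintegral_chordInterp_le_volume {n : ℕ} {Δ : Set (ℝ × ℝ)} (hconv : Convex ℝ Δ)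
    (hmeas : MeasurableSet Δ) {J : Finset ℤ} {lo hi : ℤ → ℝ}
    (hlo : ∀ j ∈ J, ((j : ℝ), lo j) ∈ Δ) (hhi : ∀ j ∈ J, ((j : ℝ), hi j) ∈ Δ)
    {N : Fin n → ℤ → ℕ} (hN : ∀ j ∈ J, ∑ i, (N i j : ℝ) ≤ hi j - lo j)
    {p q : ℤ → ℤ} {A B : ℤ}
    (hpq : ∀ z, A ≤ z → z < B → p z ∈ J ∧ q z ∈ J ∧ p z ≤ z ∧ z + 1 ≤ q z) :
    ∑ i, ∫⁻ x in Set.Ico (A : ℝ) B, ENNReal.ofReal (chordInterp p q (fun j => N i j) x) ≤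
      MeasureTheory.volume Δ := by
  rw [← MeasureTheory.lintegral_finsetSum _ fun i _ =>
    (measurable_chordInterp p q fun j => (N i j : ℝ)).ennreal_ofReal,
    MeasureTheory.Measure.volume_eq_prod, MeasureTheory.Measure.prod_apply hmeas]
  refine (MeasureTheory.setLIntegral_mono' measurableSet_Ico fun x hx => ?_).trans
    (MeasureTheory.setLIntegral_le_lintegral (Set.Ico (A : ℝ) B) _)
  obtain ⟨hp, hq, hpz, hqz⟩ := hpq ⌊x⌋ (Int.le_floor.2 hx.1) (Int.floor_lt.2 hx.2)
  obtain ⟨w, w', hw, hw', hww, hx', hc⟩ := exists_chordInterp_eq hpz hqz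
  rw [← ENNReal.ofReal_sum_of_nonneg]
  · have hsum : ∑ i, chordInterp p q (fun j => (N i j : ℝ)) x ≤
        (w * hi (p ⌊x⌋) + w' * hi (q ⌊x⌋)) - (w * lo (p ⌊x⌋) + w' * lo (q ⌊x⌋)) := by
      simp only [hc, Finset.sum_add_distrib, ← Finset.mul_sum]
      nlinarith [mul_le_mul_of_nonneg_left (hN _ hp) hw, mul_le_mul_of_nonneg_left (hN _ hq) hw']
    refine (ENNReal.ofReal_le_ofReal hsum).trans ?_
    rw [← Real.volume_Icc]
    refine MeasureTheory.measure_mono ?_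
    have hslice : Convex ℝ (Prod.mk x ⁻¹' Δ) := by
      intro y hy z hz s t hs ht hst
      have := hconv hy hz hs ht hst
      simp only [Prod.smul_mk, Prod.mk_add_mk, smul_eq_mul, ← add_mul, hst, one_mul] at this
      exact this
    refine hslice.ordConnected.out ?_ ?_
    · have := hconv (hlo _ hp) (hlo _ hq) hw hw' hww
      simp only [Prod.smul_mk, Prod.mk_add_mk, smul_eq_mul, hx'] at this
      exact this
    · have := hconv (hhi _ hp) (hhi _ hq) hw hw' hww
      simp only [Prod.smul_mk, Prod.mk_add_mk, smul_eq_mul, hx'] at this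
      exact this
  · intro i _
    rw [hc]
    positivity

theorem sum_rootMultiplicity_add_natTrailingDegree_le {F : Type*} [Field F] {n : ℕ}
    {η : Fin n → F} (hη : Function.Injective η) (hη0 : ∀ i, η i ≠ 0) {f : Polynomial F}
    (hf : f ≠ 0) :
    f.natTrailingDegree + ∑ i, f.rootMultiplicity (η i) ≤ f.natDegree := by
  have hdvd : ∏ i, (Polynomial.X - Polynomial.C (η i)) ^ f.rootMultiplicity (η i) ∣ f := by
    refine Finset.prod_dvd_of_coprime (fun i _ i' _ hne => ?_)
      fun i _ => Polynomial.pow_rootMultiplicity_dvd f (η i)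
    exact (Polynomial.pairwise_coprime_X_sub_C hη hne).pow
  have := natDegree_le_of_dvd_of_eval_zero_ne_zero hf hdvd (by
    rw [Polynomial.coeff_zero_eq_eval_zero, Polynomial.eval_prod]
    exact Finset.prod_ne_zero_iff.2 fun i _ => by simp [hη0 i])
  rwa [Polynomial.natDegree_prod_of_monic _ _ fun i _ => (Polynomial.monic_X_sub_C _).pow _,
    Finset.sum_congr rfl fun i _ => by
      rw [Polynomial.natDegree_pow, Polynomial.natDegree_X_sub_C, mul_one]] at this

theorem exists_min_argmax {Λ : Finset ℕ} (hΛ : Λ.Nonempty) (μ : ℕ → ℕ) :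
    ∃ L ∈ Λ, (∀ l ∈ Λ, μ l ≤ μ L) ∧ ∀ l ∈ Λ, l < L → μ l < μ L := by
  obtain ⟨L₀, hL₀, hmax⟩ := Λ.exists_max_image μ hΛ
  obtain ⟨L, hL, hmin⟩ := (Λ.filter fun l => μ l = μ L₀).exists_min_image id
    ⟨L₀, by simp [hL₀]⟩
  rw [Finset.mem_filter] at hL
  refine ⟨L, hL.1, fun l hl => hL.2 ▸ hmax l hl, fun l hl hlt => ?_⟩
  refine lt_of_le_of_ne (hL.2 ▸ hmax l hl) fun heq => ?_
  have := hmin l (Finset.mem_filter.2 ⟨hl, heq.trans hL.2⟩)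
  simp only [id] at this
  omega

theorem exists_le_volume_of_rows {F : Type*} [Field F] {n : ℕ} {m : Fin n → ℕ}
    {η : Fin n → F} (hη : Function.Injective η) (hη0 : ∀ i, η i ≠ 0)
    {f : ℕ → ℕ → Polynomial F} {A B E : ℕ} (hAB : A ≤ B)
    (hsupp : ∀ j e, f j e ≠ 0 → A ≤ j ∧ j ≤ B ∧ e ≤ E)
    (hA : ∃ e, f A e ≠ 0) (hB : ∃ e, f B e ≠ 0) (hm : ∀ i, m i + A ≤ B)
    {Δ : Set (ℝ × ℝ)} (hconv : Convex ℝ Δ) (hmeas : MeasurableSet Δ)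
    (hΔ : ∀ j e k, (f j e).coeff k ≠ 0 → ((j : ℝ), (k : ℝ)) ∈ Δ)
    (h : ∀ i a b, a + b < m i → ∀ d, ∑ j ∈ Finset.range (B + 1), (j.choose a : F) *
      (if (i : ℕ) * j ≤ d then
        (Polynomial.hasseDeriv b (f j (d - i * j))).eval (η i) else 0) = 0) :
    ∃ s : Fin n → ℕ, (∀ i, s i ≤ m i) ∧ ∑ i, s i + A ≤ B ∧
      ENNReal.ofReal ((1 / 2) * ∑ i, (m i : ℝ) ^ 2 - (1 / 2) * ∑ i, (s i : ℝ) ^ 2) ≤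
        MeasureTheory.volume Δ := by
  classical
  set J : Finset ℕ := (Finset.range (B + 1)).filter fun j => ∃ e, f j e ≠ 0 with hJdef
  have hJ : ∀ j, j ∈ J ↔ j < B + 1 ∧ ∃ e, f j e ≠ 0 := fun j => by simp [hJdef]
  have hJAB : ∀ j ∈ J, A ≤ j ∧ j ≤ B := fun j hj => by
    obtain ⟨_, e, he⟩ := (hJ j).1 hj
    exact ⟨(hsupp j e he).1, (hsupp j e he).2.1⟩
  have hAJ : A ∈ J := (hJ A).2 ⟨by omega, hA⟩
  have hBJ : B ∈ J := (hJ B).2 ⟨by omega, hB⟩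
  have hgex : ∀ j ∈ J, ∃ g, f j g ≠ 0 ∧ ∀ e, f j e ≠ 0 → e ≤ g := fun j hj => by
    have hbdd : BddAbove {e | f j e ≠ 0} := ⟨E, fun e he => (hsupp j e he).2.2⟩
    exact ⟨_, Nat.sSup_mem ((hJ j).1 hj).2 hbdd, fun e he => le_csSup hbdd he⟩
  choose! g hg using hgex
  set N : Fin n → ℕ → ℕ := fun i j => (f j (g j)).rootMultiplicity (η i) with hNdef
  have hrow := fun i : Fin n => exists_row_data (η := η i) (i := i) (m := m i) hJ hg (h i)
  choose μ a b hμ hab using hrow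
  have hL := fun i => exists_min_argmax (Λ := J.image (N i)) ⟨_, Finset.mem_image_of_mem _ hAJ⟩
    (μ i)
  choose L hLΛ hLmax hLmin using hL
  have hmaximal : ∀ i, ∀ j ∈ J, g j + i * j ≤ μ i (L i) := fun i j hj =>
    (hμ i j hj).trans (hLmax i _ (Finset.mem_image_of_mem _ hj))
  refine ⟨fun i => m i - L i, fun i => Nat.sub_le _ _, ?_, ?_⟩
  · have hpack := sum_sub_add_le_of_pairwise_le hAB
      (fun i => (hJAB _ (hab i _ (hLΛ i)).1).1) (fun i => (hJAB _ (hab i _ (hLΛ i)).2.1).2)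
      fun i i' hii' => ?_
    · refine le_trans (Nat.add_le_add_right (Finset.sum_le_sum fun i _ => ?_) A) hpack
      have := (hab i _ (hLΛ i)).2.2.2.1
      omega
    · obtain ⟨-, hb, -, -, -, hbμ⟩ := hab i _ (hLΛ i)
      obtain ⟨ha, -, -, -, haμ, -⟩ := hab i' _ (hLΛ i')
      have h1 := (hmaximal i _ ha).trans hbμ
      have h2 := (hmaximal i' _ hb).trans haμ
      have h3 : (i : ℕ) < i' := hii'
      by_contra! hlt
      nlinarith
  · have hchord : ∀ z : ℤ, (A : ℤ) ≤ z → z < B → ∃ p q : ℤ, ∃ κ θ : ℝ,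
        p ∈ J.image (Nat.cast : ℕ → ℤ) ∧ q ∈ J.image (Nat.cast : ℕ → ℤ) ∧ p ≤ z ∧ z + 1 ≤ q ∧
        (∀ j ∈ J.image (Nat.cast : ℕ → ℤ), (g j.toNat : ℝ) ≤ κ + θ * j) ∧
        (g p.toNat : ℝ) = κ + θ * p ∧ (g q.toNat : ℝ) = κ + θ * q := by
      intro z hAz hzB
      have hAz' : (A : ℝ) ≤ z := by exact_mod_cast hAz
      have hzB' : (z : ℝ) + 1 ≤ B := by exact_mod_cast hzB
      obtain ⟨p, hp, q, hq, hpz, hqz, κ, θ, hle, hpe, hqe⟩ := exists_supporting_chord J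
        (fun j => (j : ℝ)) (fun j => (g j : ℝ)) (z + 1 / 2)
        (fun j _ hj => by
          have h1 : (2 * j : ℝ) = 2 * z + 1 := by linarith
          have h2 : (2 * j : ℤ) = 2 * z + 1 := by exact_mod_cast h1
          omega)
        ⟨A, hAJ, by linarith⟩ ⟨B, hBJ, by linarith⟩
      refine ⟨p, q, κ, θ, Finset.mem_image_of_mem _ hp, Finset.mem_image_of_mem _ hq, ?_, ?_,
        ?_, by simpa using hpe, by simpa using hqe⟩
      · have h1 : (p : ℝ) < (z + 1 : ℤ) := by push_cast; linarith
        have h2 : (p : ℤ) < z + 1 := by exact_mod_cast h1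
        omega
      · have h1 : (z : ℝ) < q := by linarith
        have h2 : z < (q : ℤ) := by exact_mod_cast h1
        omega
      · intro j hj
        obtain ⟨j, hj', rfl⟩ := Finset.mem_image.1 hj
        simpa using hle j hj'
    choose! p q κ θ hpq using hchord
    refine le_trans ?_ (sum_lintegral_chordInterp_le_volume hconv hmeas
      (J := J.image (Nat.cast : ℕ → ℤ)) (lo := fun j => (f j.toNat (g j.toNat)).natTrailingDegree)
      (hi := fun j => (f j.toNat (g j.toNat)).natDegree)
      (N := fun i j => N i j.toNat) (p := p) (q := q) (A := A) (B := B) ?_ ?_ ?_ ?_)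
    · have heq : (1 / 2) * ∑ i, (m i : ℝ) ^ 2 - (1 / 2) * ∑ i, ((m i - L i : ℕ) : ℝ) ^ 2 =
          ∑ i, ((1 / 2) * (m i : ℝ) ^ 2 - (1 / 2) * ((m i - L i : ℕ) : ℝ) ^ 2) := by
        rw [Finset.sum_sub_distrib, Finset.mul_sum, Finset.mul_sum]
      rw [heq, ENNReal.ofReal_sum_of_nonneg]
      · refine Finset.sum_le_sum fun i _ => ?_
        refine ofReal_le_lintegral_chordInterp (J := J.image (Nat.cast : ℕ → ℤ))
          (Λ := J.image (N i)) (n := fun j => N i j.toNat)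
          (G := fun j => g j.toNat + i * j) (μ := fun l => μ i l) (κ := κ)
          (θ := fun z => θ z + i) (a := fun l => a i l) (b := fun l => b i l)
          (L := L i) ?_ ?_ ?_ ?_ ?_ (hLΛ i) ?_
        · intro j hj
          obtain ⟨j, hj', rfl⟩ := Finset.mem_image.1 hj
          have := hJAB j hj'
          omega
        · have := hm i
          omega
        · intro j hj
          obtain ⟨j, hj', rfl⟩ := Finset.mem_image.1 hj
          refine ⟨Finset.mem_image_of_mem _ hj', ?_⟩
          have := hμ i j hj'
          simpa using (by exact_mod_cast this : (g j : ℝ) + i * j ≤ μ i (N i j))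
        · intro z hAz hzB
          obtain ⟨h1, h2, h3, h4, h5, h6, h7⟩ := hpq z hAz hzB
          refine ⟨h1, h2, h3, h4, fun j hj => ?_, ?_, ?_⟩
          · have := h5 j hj
            linarith
          · linarith
          · linarith
        · intro l hl
          obtain ⟨h1, h2, h3, h4, h5, h6⟩ := hab i l hl
          refine ⟨Finset.mem_image_of_mem _ h1, Finset.mem_image_of_mem _ h2, by omega, ?_, ?_⟩
          · simpa using (by exact_mod_cast h5 : (μ i l : ℝ) ≤ g (a i l) + i * a i l)
          · simpa using (by exact_mod_cast h6 : (μ i l : ℝ) ≤ g (b i l) + i * b i l)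
        · intro l hl hlt
          exact_mod_cast hLmin i l hl hlt
      · intro i _
        have : ((m i - L i : ℕ) : ℝ) ≤ m i := by exact_mod_cast Nat.sub_le _ _
        nlinarith [Nat.cast_nonneg (α := ℝ) (m i - L i)]
    · intro j hj
      obtain ⟨j, hj', rfl⟩ := Finset.mem_image.1 hj
      have := hΔ j (g j) _ (Polynomial.trailingCoeff_nonzero_iff_nonzero.2 (hg j hj').1)
      simpa using this
    · intro j hj
      obtain ⟨j, hj', rfl⟩ := Finset.mem_image.1 hj
      have := hΔ j (g j) _ (Polynomial.leadingCoeff_ne_zero.2 (hg j hj').1)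
      simpa using this
    · intro j hj
      obtain ⟨j, hj', rfl⟩ := Finset.mem_image.1 hj
      have := sum_rootMultiplicity_add_natTrailingDegree_le hη hη0 (hg j hj').1
      rw [le_sub_iff_add_le, add_comm]
      simp only [Int.toNat_natCast]
      exact_mod_cast this
    · exact fun z h1 h2 => ⟨(hpq z h1 h2).1, (hpq z h1 h2).2.1, (hpq z h1 h2).2.2.1,
        (hpq z h1 h2).2.2.2.1⟩

theorem exists_le_volume_of_kernel_vector {F : Type*} [Field F] {n : ℕ} {m : Fin n → ℕ}
    {η : Fin n → F} (hη : Function.Injective η) (hη0 : ∀ i, η i ≠ 0)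
    {ι : Type*} [Fintype ι] {j k : ι → ℕ} (hjk : Function.Injective fun v => (j v, k v))
    {A B : ℕ} (hAB : A ≤ B) (hj : ∀ v, A ≤ j v ∧ j v ≤ B) (hm : ∀ i, m i + A ≤ B)
    {c : ι → Polynomial F} (hA : ∃ v, j v = A ∧ c v ≠ 0) (hB : ∃ v, j v = B ∧ c v ≠ 0)
    {Δ : Set (ℝ × ℝ)} (hconv : Convex ℝ Δ) (hmeas : MeasurableSet Δ)
    (hΔ : ∀ v, ((j v : ℝ), (k v : ℝ)) ∈ Δ)
    (h : ∀ i a b, a + b < m i → ∑ v, Polynomial.C (((j v).choose a : F) *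
      (((k v).choose b : F) * η i ^ (k v - b))) * Polynomial.X ^ ((i : ℕ) * j v) * c v = 0) :
    ∃ s : Fin n → ℕ, (∀ i, s i ≤ m i) ∧ ∑ i, s i + A ≤ B ∧
      ENNReal.ofReal ((1 / 2) * ∑ i, (m i : ℝ) ^ 2 - (1 / 2) * ∑ i, (s i : ℝ) ^ 2) ≤
        MeasureTheory.volume Δ := by
  classical
  set f : ℕ → ℕ → Polynomial F := fun x e =>
    ∑ v, if j v = x then Polynomial.monomial (k v) ((c v).coeff e) else 0 with hf
  have hcoeff : ∀ x e y, (f x e).coeff y ≠ 0 → ∃ v, j v = x ∧ k v = y ∧ (c v).coeff e ≠ 0 := by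
    intro x e y hne
    rw [hf, Polynomial.finsetSum_coeff] at hne
    obtain ⟨v, -, hv⟩ := Finset.exists_ne_zero_of_sum_ne_zero hne
    split_ifs at hv with hx
    · rw [Polynomial.coeff_monomial] at hv
      split_ifs at hv with hy
      · exact ⟨v, hx, hy, hv⟩
      · exact absurd rfl hv
    · exact absurd rfl hv
  have hne : ∀ v, c v ≠ 0 → ∃ e, f (j v) e ≠ 0 := by
    intro v hv
    refine ⟨(c v).natDegree, fun h0 => hv (Polynomial.leadingCoeff_eq_zero.1 ?_)⟩
    have := congrArg (fun P => Polynomial.coeff P (k v)) h0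
    simp only [hf, Polynomial.finsetSum_coeff, Polynomial.coeff_zero] at this
    rw [Finset.sum_eq_single v] at this
    · simpa using this
    · intro w _ hw
      split_ifs with hx
      · rw [Polynomial.coeff_monomial, if_neg]
        exact fun hy => hw (hjk (Prod.ext hx hy))
      · simp
    · simp
  refine exists_le_volume_of_rows hη hη0 (f := f) (E := ∑ v, (c v).natDegree) hAB ?_ ?_ ?_ hm
    hconv hmeas ?_ ?_
  · intro x e hxe
    obtain ⟨y, hy⟩ : ∃ y, (f x e).coeff y ≠ 0 := by
      by_contra! hcon
      exact hxe (Polynomial.ext fun y => by simpa using hcon y)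
    obtain ⟨v, rfl, -, hv⟩ := hcoeff x e y hy
    exact ⟨(hj v).1, (hj v).2, (Polynomial.le_natDegree_of_ne_zero hv).trans
      (Finset.single_le_sum (f := fun v => (c v).natDegree) (fun _ _ => Nat.zero_le _)
        (Finset.mem_univ v))⟩
  · obtain ⟨v, rfl, hv⟩ := hA
    exact hne v hv
  · obtain ⟨v, rfl, hv⟩ := hB
    exact hne v hv
  · intro x e y hxy
    obtain ⟨v, rfl, rfl, -⟩ := hcoeff x e y hxy
    exact hΔ v
  · intro i a b hab d
    have hd := congrArg (fun P => Polynomial.coeff P d) (h i a b hab)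
    simp only [Polynomial.finsetSum_coeff, Polynomial.coeff_zero] at hd
    refine Eq.trans ?_ hd
    have hcol : ∀ x, (x.choose a : F) * (if (i : ℕ) * x ≤ d then
        (Polynomial.hasseDeriv b (f x (d - i * x))).eval (η i) else 0) =
        ∑ v, if j v = x then (Polynomial.C (((j v).choose a : F) *
          (((k v).choose b : F) * η i ^ (k v - b))) * Polynomial.X ^ ((i : ℕ) * j v) *
            c v).coeff d else 0 := by
      intro x
      have hterm : ∀ v, (Polynomial.C (((j v).choose a : F) *
          (((k v).choose b : F) * η i ^ (k v - b))) * Polynomial.X ^ ((i : ℕ) * j v) *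
            c v).coeff d = if (i : ℕ) * j v ≤ d then (j v).choose a * (((k v).choose b : F) *
              η i ^ (k v - b) * (c v).coeff (d - i * j v)) else 0 := by
        intro v
        rw [mul_assoc, Polynomial.coeff_C_mul, mul_comm (Polynomial.X ^ _),
          Polynomial.coeff_mul_X_pow']
        split_ifs <;> ring
      split_ifs with hx
      · rw [hf, map_sum, Polynomial.eval_finsetSum, Finset.mul_sum]
        refine Finset.sum_congr rfl fun v _ => ?_
        split_ifs with hv
        · subst hv
          rw [hterm, if_pos hx, Polynomial.hasseDeriv_monomial, Polynomial.eval_monomial]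
          ring
        · simp
      · rw [mul_zero, Finset.sum_eq_zero]
        intro v _
        split_ifs with hv
        · subst hv
          rw [hterm, if_neg hx]
        · rfl
    rw [Finset.sum_congr rfl fun x _ => hcol x, Finset.sum_comm]
    refine Finset.sum_congr rfl fun v _ => ?_
    rw [Finset.sum_ite_eq, if_pos (Finset.mem_range.2 (by have := (hj v).2; omega))]

theorem exists_kernel_vector_of_two {F ι ρ : Type*} [Field F] [Infinite F] [Fintype ι]
    [Fintype ρ] (M : ρ → ι → Polynomial F) (P Q : Set ι)
    (h : ∀ τ : F, τ ≠ 0 → ∃ c : ι → F, (∀ r, ∑ v, (M r v).eval τ * c v = 0) ∧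
      (∃ v ∈ P, c v ≠ 0) ∧ ∃ v ∈ Q, c v ≠ 0) :
    ∃ c : ι → Polynomial F, (∀ r, ∑ v, M r v * c v = 0) ∧
      (∃ v ∈ P, c v ≠ 0) ∧ ∃ v ∈ Q, c v ≠ 0 := by
  obtain ⟨c, hc, hcP⟩ := exists_kernel_vector M P fun τ hτ =>
    (h τ hτ).imp fun c hc => ⟨hc.1, hc.2.1⟩
  obtain ⟨d, hd, hdQ⟩ := exists_kernel_vector M Q fun τ hτ =>
    (h τ hτ).imp fun c hc => ⟨hc.1, hc.2.2⟩
  by_cases hcQ : ∃ v ∈ Q, c v ≠ 0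
  · exact ⟨c, hc, hcP, hcQ⟩
  by_cases hdP : ∃ v ∈ P, d v ≠ 0
  · exact ⟨d, hd, hdP, hdQ⟩
  push Not at hcQ hdP
  refine ⟨c + d, fun r => ?_, ?_, ?_⟩
  · simp only [Pi.add_apply, mul_add, Finset.sum_add_distrib, hc r, hd r, add_zero]
  · obtain ⟨v, hv, hne⟩ := hcP
    exact ⟨v, hv, by simpa [hdP v hv] using hne⟩
  · obtain ⟨v, hv, hne⟩ := hdQ
    exact ⟨v, hv, by simpa [hcQ v hv] using hne⟩

theorem exists_le_of_mem_convexHull {s : Set (ℝ × ℝ)} {x : ℝ × ℝ} (hx : x ∈ convexHull ℝ s)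
    (α β : ℝ) : ∃ y ∈ s, α * y.1 + β * y.2 ≤ α * x.1 + β * x.2 := by
  by_contra! hcon
  have hconv : Convex ℝ {y : ℝ × ℝ | α * x.1 + β * x.2 < α * y.1 + β * y.2} :=
    convex_halfSpace_gt (f := fun y : ℝ × ℝ => α * y.1 + β * y.2)
      ⟨fun y z => by simp only [Prod.fst_add, Prod.snd_add]; ring,
        fun a y => by simp only [Prod.smul_fst, Prod.smul_snd, smul_eq_mul]; ring⟩ _
  exact lt_irrefl (α * x.1 + β * x.2) (convexHull_min (fun y hy => hcon y hy) hconv hx)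

/-- The linear form `u` on a lattice polygon has integral extrema, attained at lattice points,
and their difference is the lattice width. -/
theorem exists_latticeWidth_eq {S : Finset (ℤ × ℤ)} (hS : S.Nonempty) {Δ : Set (ℝ × ℝ)}
    (hΔ : Δ = convexHull ℝ ((fun p : ℤ × ℤ => ((p.1 : ℝ), (p.2 : ℝ))) '' ↑S)) (u : ℤ × ℤ) :
    ∃ A B : ℤ, (∀ x ∈ Δ, (A : ℝ) ≤ u.1 * x.1 + u.2 * x.2 ∧ u.1 * x.1 + u.2 * x.2 ≤ B) ∧
      (∃ p : ℤ × ℤ, ((p.1 : ℝ), (p.2 : ℝ)) ∈ Δ ∧ u.1 * p.1 + u.2 * p.2 = A) ∧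
      (∃ p : ℤ × ℤ, ((p.1 : ℝ), (p.2 : ℝ)) ∈ Δ ∧ u.1 * p.1 + u.2 * p.2 = B) ∧
      latticeWidth u Δ = B - A := by
  obtain ⟨p, hp, hpmin⟩ := S.exists_min_image (fun p => u.1 * p.1 + u.2 * p.2) hS
  obtain ⟨q, hq, hqmax⟩ := S.exists_max_image (fun p => u.1 * p.1 + u.2 * p.2) hS
  have hmem : ∀ p ∈ S, ((p.1 : ℝ), (p.2 : ℝ)) ∈ Δ := fun p hp => by
    rw [hΔ]
    exact subset_convexHull ℝ _ ⟨p, hp, rfl⟩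
  have hbd : ∀ x ∈ Δ, ((u.1 * p.1 + u.2 * p.2 : ℤ) : ℝ) ≤ u.1 * x.1 + u.2 * x.2 ∧
      u.1 * x.1 + u.2 * x.2 ≤ ((u.1 * q.1 + u.2 * q.2 : ℤ) : ℝ) := by
    intro x hx
    rw [hΔ] at hx
    constructor
    · obtain ⟨_, ⟨y, hy, rfl⟩, hle⟩ := exists_le_of_mem_convexHull hx u.1 u.2
      refine le_trans ?_ hle
      dsimp only
      exact_mod_cast hpmin y hy
    · obtain ⟨_, ⟨y, hy, rfl⟩, hle⟩ := exists_le_of_mem_convexHull hx (-u.1) (-u.2)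
      have h1 : ((u.1 * y.1 + u.2 * y.2 : ℤ) : ℝ) ≤ ((u.1 * q.1 + u.2 * q.2 : ℤ) : ℝ) := by
        exact_mod_cast hqmax y hy
      push_cast at h1 hle ⊢
      linarith
  refine ⟨_, _, hbd, ⟨p, hmem p hp, rfl⟩, ⟨q, hmem q hq, rfl⟩, ?_⟩
  refine IsGreatest.csSup_eq ⟨⟨_, hmem q hq, _, hmem p hp, by push_cast; ring⟩, ?_⟩
  rintro w ⟨x, hx, y, hy, rfl⟩
  have h1 := (hbd x hx).2
  have h2 := (hbd y hy).1
  linarith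

theorem exists_isCoprime_minLatticeWidth_eq {S : Finset (ℤ × ℤ)} (hS : S.Nonempty)
    {Δ : Set (ℝ × ℝ)}
    (hΔ : Δ = convexHull ℝ ((fun p : ℤ × ℤ => ((p.1 : ℝ), (p.2 : ℝ))) '' ↑S)) :
    ∃ u : ℤ × ℤ, IsCoprime u.1 u.2 ∧ minLatticeWidth Δ = latticeWidth u Δ := by
  classical
  have hnat : ∀ u : ℤ × ℤ, ∃ N : ℕ, latticeWidth u Δ = N := by
    intro u
    obtain ⟨A, B, hbd, ⟨p, hp, hpA⟩, -, hw⟩ := exists_latticeWidth_eq hS hΔ u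
    have hAB : A ≤ B := by
      have := (hbd _ hp).1.trans (hbd _ hp).2
      exact_mod_cast this
    refine ⟨(B - A).toNat, ?_⟩
    rw [hw, ← Int.cast_sub, ← Int.cast_natCast, Int.toNat_of_nonneg (by omega)]
  have hex : ∃ N : ℕ, ∃ u : ℤ × ℤ, u ≠ 0 ∧ latticeWidth u Δ = N := by
    obtain ⟨N, hN⟩ := hnat (1, 0)
    exact ⟨N, (1, 0), by simp, hN⟩
  obtain ⟨u, hu, huN⟩ := Nat.find_spec hex
  have hmin : ∀ u' : ℤ × ℤ, u' ≠ 0 → latticeWidth u Δ ≤ latticeWidth u' Δ := by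
    intro u' hu'
    obtain ⟨N, hN⟩ := hnat u'
    rw [huN, hN]
    exact_mod_cast Nat.find_min' hex ⟨u', hu', hN⟩
  have hu0 : 0 < Int.gcd u.1 u.2 := by
    rw [Int.gcd_pos_iff]
    by_contra! hcon
    exact hu (Prod.ext hcon.1 hcon.2)
  obtain ⟨v₁, v₂, hcop, h1, h2⟩ := Int.exists_gcd_one hu0
  have hv : ((v₁, v₂) : ℤ × ℤ) ≠ 0 := by
    rintro hv
    rw [Prod.mk_eq_zero] at hv
    exact hu (Prod.ext (by rw [h1, hv.1, zero_mul]; rfl) (by rw [h2, hv.2, zero_mul]; rfl))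
  refine ⟨(v₁, v₂), Int.isCoprime_iff_gcd_eq_one.2 hcop, ?_⟩
  have hle : latticeWidth (v₁, v₂) Δ ≤ latticeWidth u Δ := by
    obtain ⟨A, B, hbd, -, -, hw⟩ := exists_latticeWidth_eq hS hΔ u
    obtain ⟨A', B', hbd', ⟨p, hp, hpA⟩, ⟨q, hq, hqB⟩, hw'⟩ :=
      exists_latticeWidth_eq hS hΔ (v₁, v₂)
    have hp1 := (hbd _ hp).1
    have hq1 := (hbd _ hq).2
    have hpB := (hbd' _ hp).2
    rw [hw, hw']
    simp only at hpA hqB hpB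
    have hpA' : (v₁ * p.1 + v₂ * p.2 : ℝ) = A' := by exact_mod_cast hpA
    have hqB' : (v₁ * q.1 + v₂ * q.2 : ℝ) = B' := by exact_mod_cast hqB
    have h1' : (u.1 : ℝ) = v₁ * (Int.gcd u.1 u.2 : ℕ) := by exact_mod_cast h1
    have h2' : (u.2 : ℝ) = v₂ * (Int.gcd u.1 u.2 : ℕ) := by exact_mod_cast h2
    have hg : (1 : ℝ) ≤ (Int.gcd u.1 u.2 : ℕ) := by exact_mod_cast hu0
    rw [h1', h2'] at hp1 hq1
    nlinarith
  refine IsLeast.csInf_eq ⟨⟨_, hv, rfl⟩, ?_⟩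
  rintro w ⟨u', hu', rfl⟩
  exact hle.trans (hmin u' hu')

theorem unimodular_image {u w : ℤ × ℤ} (hdet : u.1 * w.2 - u.2 * w.1 = 1) (z : ℝ × ℝ)
    {Δ : Set (ℝ × ℝ)} (hconv : Convex ℝ Δ) (hcomp : IsCompact Δ) :
    ∃ Δ' : Set (ℝ × ℝ), Convex ℝ Δ' ∧ MeasurableSet Δ' ∧
      MeasureTheory.volume Δ' = MeasureTheory.volume Δ ∧
      ∀ x ∈ Δ, (u.1 * x.1 + u.2 * x.2 + z.1, w.1 * x.1 + w.2 * x.2 + z.2) ∈ Δ' := by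
  set T : ℝ × ℝ →ₗ[ℝ] ℝ × ℝ := Matrix.toLin (Module.Basis.finTwoProd ℝ)
    (Module.Basis.finTwoProd ℝ) !![(u.1 : ℝ), (u.2 : ℝ); (w.1 : ℝ), (w.2 : ℝ)] with hT
  have hTdet : LinearMap.det T = 1 := by
    rw [hT, LinearMap.det_toLin, Matrix.det_fin_two_of]
    exact_mod_cast hdet
  refine ⟨(fun x => z + x) '' (T '' Δ), (hconv.linear_image T).translate z, ?_, ?_, ?_⟩
  · exact ((hcomp.image T.continuous_of_finiteDimensional).image
      (continuous_const_add z)).measurableSet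
  · rw [Set.image_add_left, MeasureTheory.measure_preimage_add,
      MeasureTheory.Measure.addHaar_image_linearMap, hTdet]
    simp
  · intro x hx
    refine ⟨T x, ⟨x, hx, rfl⟩, ?_⟩
    rw [hT, Matrix.toLin_finTwoProd_apply]
    exact Prod.ext (add_comm _ _) (add_comm _ _)

theorem exists_finset_mem_iff {Δ : Set (ℝ × ℝ)} (hcomp : IsCompact Δ) :
    ∃ S : Finset (Fin 2 →₀ ℕ), ∀ v, v ∈ S ↔ ((v 0 : ℝ), (v 1 : ℝ)) ∈ Δ := by
  obtain ⟨R, hR⟩ := hcomp.isBounded.exists_norm_le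
  have hfin : {v : Fin 2 →₀ ℕ | ((v 0 : ℝ), (v 1 : ℝ)) ∈ Δ}.Finite := by
    refine (Set.finite_Icc (0 : Fin 2 →₀ ℕ)
      (Finsupp.equivFunOnFinite.symm fun _ => ⌈R⌉₊)).subset fun v hv => ⟨zero_le, fun i => ?_⟩
    have h := hR _ hv
    rw [Prod.norm_mk, sup_le_iff, Real.norm_natCast, Real.norm_natCast] at h
    have : (v i : ℝ) ≤ ⌈R⌉₊ := by
      fin_cases i
      · exact h.1.trans (Nat.le_ceil R)
      · exact h.2.trans (Nat.le_ceil R)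
    simpa using (by exact_mod_cast this : v i ≤ ⌈R⌉₊)
  exact ⟨hfin.toFinset, fun v => by simp⟩

theorem exists_mem_support_eq_of_newtonPolygon_eq {F : Type*} [Field F]
    {f : MvPolynomial (Fin 2) F} {Δ : Set (ℝ × ℝ)} (hf : newtonPolygon f = Δ) {u : ℤ × ℤ} {A : ℤ}
    (hA : ∀ x ∈ Δ, (A : ℝ) ≤ u.1 * x.1 + u.2 * x.2) {p : ℤ × ℤ}
    (hp : ((p.1 : ℝ), (p.2 : ℝ)) ∈ Δ) (hpA : u.1 * p.1 + u.2 * p.2 = A) :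
    ∃ v ∈ f.support, u.1 * (v 0 : ℤ) + u.2 * (v 1 : ℤ) = A := by
  rw [← hf] at hp
  obtain ⟨_, ⟨v, hv, rfl⟩, hle⟩ := exists_le_of_mem_convexHull hp u.1 u.2
  refine ⟨v, hv, le_antisymm ?_ ?_⟩
  · rw [← hpA]
    dsimp only at hle
    exact_mod_cast hle
  · have hmem : ((v 0 : ℝ), (v 1 : ℝ)) ∈ Δ := hf ▸ subset_convexHull ℝ _ ⟨v, hv, rfl⟩
    have hle' := hA _ hmem
    dsimp only at hle'
    exact_mod_cast hle'

theorem exists_le_volume_of_isLatticePolygon {F : Type*} [Field F] [Infinite F] {n : ℕ}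
    {m : Fin n → ℕ} {Δ : Set (ℝ × ℝ)} (hΔ : IsLatticePolygon Δ)
    (hω : ∀ i, (m i : ℝ) ≤ minLatticeWidth Δ)
    (hcurve : ∀ p : Fin n → F × F, ∃ f : MvPolynomial (Fin 2) F,
      newtonPolygon f = Δ ∧ ∀ i, multAtLeast (p i) (m i) f) :
    ∃ s : Fin n → ℕ, (∀ i, s i ≤ m i) ∧ ∑ i, (s i : ℝ) ≤ minLatticeWidth Δ ∧
      ENNReal.ofReal ((1 / 2) * ∑ i, (m i : ℝ) ^ 2 - (1 / 2) * ∑ i, (s i : ℝ) ^ 2) ≤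
        MeasureTheory.volume Δ := by
  classical
  obtain ⟨⟨V, hV⟩, hint⟩ := hΔ
  have hVne : V.Nonempty := by
    rw [Finset.nonempty_iff_ne_empty]
    rintro rfl
    simp [hV] at hint
  have hconv : Convex ℝ Δ := hV ▸ convex_convexHull ℝ _
  have hcomp : IsCompact Δ := hV ▸ (V.finite_toSet.image _).isCompact_convexHull ℝ
  obtain ⟨S, hS⟩ := exists_finset_mem_iff hcomp
  obtain ⟨u, hu, huω⟩ := exists_isCoprime_minLatticeWidth_eq hVne hV
  obtain ⟨s, t, hst⟩ := hu
  set w : ℤ × ℤ := (-t, s) with hw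
  have hdet : u.1 * w.2 - u.2 * w.1 = 1 := by
    rw [hw]
    linear_combination hst
  obtain ⟨A, B, hbd, ⟨pA, hpA, hpA'⟩, ⟨pB, hpB, hpB'⟩, huw⟩ := exists_latticeWidth_eq hVne hV u
  obtain ⟨A', B', hbd', -, -, -⟩ := exists_latticeWidth_eq hVne hV w
  have hAB : A ≤ B := by exact_mod_cast (hbd _ hpA).1.trans (hbd _ hpA).2
  have hωAB : minLatticeWidth Δ = ((B - A).toNat : ℕ) := by
    rw [huω, huw, ← Int.cast_sub, ← Int.cast_natCast (R := ℝ), Int.toNat_of_nonneg (by omega)]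
  obtain ⟨Δ', hconv', hmeas', hvol, hmem'⟩ :=
    unimodular_image hdet (-(A : ℝ), -(A' : ℝ)) hconv hcomp
  set j : (Fin 2 →₀ ℕ) → ℕ := fun v => (u.1 * v 0 + u.2 * v 1 + -A).toNat with hj
  set k : (Fin 2 →₀ ℕ) → ℕ := fun v => (w.1 * v 0 + w.2 * v 1 + -A').toNat with hk
  have hjS : ∀ v ∈ S, (j v : ℤ) = u.1 * v 0 + u.2 * v 1 + -A ∧ j v ≤ (B - A).toNat := by
    intro v hv
    have hv' := hbd _ ((hS v).1 hv)
    dsimp only at hv'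
    have h1 : A ≤ u.1 * v 0 + u.2 * v 1 := by exact_mod_cast hv'.1
    have h2 : u.1 * v 0 + u.2 * v 1 ≤ B := by exact_mod_cast hv'.2
    simp only [hj]
    omega
  have hkS : ∀ v ∈ S, (k v : ℤ) = w.1 * v 0 + w.2 * v 1 + -A' := by
    intro v hv
    have hv' := hbd' _ ((hS v).1 hv)
    dsimp only at hv'
    have h1 : A' ≤ w.1 * v 0 + w.2 * v 1 := by exact_mod_cast hv'.1
    simp only [hk]
    omega
  obtain ⟨η, hη, hη0⟩ : ∃ η : Fin n → F, Function.Injective η ∧ ∀ i, η i ≠ 0 := by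
    let e : Fin n ↪ {x : F // x ≠ 0} :=
      Fin.valEmbedding.trans
        (@Infinite.natEmbedding _
          (Set.infinite_coe_iff.2 (Set.finite_singleton (0 : F)).infinite_compl))
    exact ⟨fun i => e i, Subtype.val_injective.comp e.injective, fun i => (e i).2⟩
  obtain ⟨c, hc, hcA, hcB⟩ := exists_kernel_vector_of_two (F := F) (ι := S)
    (ρ := Σ i : Fin n, Fin (m i) × Fin (m i))
    (fun r v => if (r.2.1 : ℕ) + r.2.2 < m r.1 then Polynomial.C (((j v).choose r.2.1 : F) *
      (((k v).choose r.2.2 : F) * η r.1 ^ (k v - r.2.2))) * Polynomial.X ^ ((r.1 : ℕ) * j v)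
      else 0) {v | j v = 0} {v | j v = (B - A).toNat} (by
    intro τ hτ
    obtain ⟨f, hfΔ, hf⟩ := hcurve fun i => ((τ ^ (i : ℕ)) ^ u.1 * η i ^ w.1,
      (τ ^ (i : ℕ)) ^ u.2 * η i ^ w.2)
    have hfS : f.support ⊆ S := fun v hv => (hS v).2 (hfΔ ▸ subset_convexHull ℝ _ ⟨v, hv, rfl⟩)
    refine ⟨fun v => f.coeff v, ?_, ?_, ?_⟩
    · rintro ⟨i, a, b⟩
      dsimp only
      by_cases hab : (a : ℕ) + b < m i
      · have hsum := sum_choose_eq_zero_of_multAtLeast (pow_ne_zero (i : ℕ) hτ) (hη0 i) u w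
          (-A) (-A') (hf i) j k (fun v hv => (hjS v (hfS hv)).1) (fun v hv => hkS v (hfS hv)) hab
        simp only [if_pos hab]
        refine (Finset.sum_coe_sort S fun v => (Polynomial.C (((j v).choose a : F) *
          (((k v).choose b : F) * η i ^ (k v - b))) * Polynomial.X ^ ((i : ℕ) * j v)).eval τ *
            f.coeff v).trans ?_
        rw [← Finset.sum_subset hfS fun v _ hv => by
          rw [MvPolynomial.notMem_support_iff.1 hv, mul_zero]]
        have hmul := congrArg (fun y => (τ ^ (i : ℕ)) ^ (a : ℕ) * y) hsum
        simp only [mul_zero, Finset.mul_sum] at hmul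
        rw [← hmul]
        refine Finset.sum_congr rfl fun v _ => ?_
        simp only [Polynomial.eval_mul, Polynomial.eval_C, Polynomial.eval_pow, Polynomial.eval_X]
        rcases le_or_gt (a : ℕ) (j v) with h | h
        · rw [pow_mul, ← pow_mul_pow_sub _ h]
          ring
        · rw [Nat.choose_eq_zero_of_lt h]
          simp
      · simp [if_neg hab]
    · obtain ⟨v, hv, hvA⟩ := exists_mem_support_eq_of_newtonPolygon_eq hfΔ
        (fun x hx => (hbd x hx).1) hpA hpA'
      refine ⟨⟨v, hfS hv⟩, ?_, MvPolynomial.mem_support_iff.1 hv⟩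
      have := (hjS v (hfS hv)).1
      simp only [Set.mem_ofPred_eq]
      omega
    · obtain ⟨v, hv, hvB⟩ := exists_mem_support_eq_of_newtonPolygon_eq (u := -u) (A := -B) hfΔ
        (fun x hx => by
          have := (hbd x hx).2
          push_cast [Prod.fst_neg, Prod.snd_neg]
          linarith) hpB (by
          simp only [Prod.fst_neg, Prod.snd_neg]
          linarith)
      refine ⟨⟨v, hfS hv⟩, ?_, MvPolynomial.mem_support_iff.1 hv⟩
      have := (hjS v (hfS hv)).1
      simp only [Prod.fst_neg, Prod.snd_neg] at hvB
      simp only [Set.mem_ofPred_eq]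
      have : (j v : ℤ) = B - A := by linarith
      omega)
  have hinj : Function.Injective fun v : S => (j v, k v) := by
    intro v v' hvv
    simp only [Prod.mk.injEq] at hvv
    have h1 := (hjS v v.2).1
    have h2 := (hjS v' v'.2).1
    have h3 := hkS v v.2
    have h4 := hkS v' v'.2
    rw [hvv.1] at h1
    rw [hvv.2] at h3
    have h0 : (v.1 0 : ℤ) = v'.1 0 := by
      linear_combination w.2 * (h2 - h1) - u.2 * (h4 - h3) +
        ((v'.1 0 : ℤ) - v.1 0) * hdet
    have h0' : (v.1 1 : ℤ) = v'.1 1 := by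
      linear_combination u.1 * (h4 - h3) - w.1 * (h2 - h1) +
        ((v'.1 1 : ℤ) - v.1 1) * hdet
    refine Subtype.ext (Finsupp.ext fun i => ?_)
    fin_cases i
    · exact_mod_cast h0
    · exact_mod_cast h0'
  have hmω : ∀ i, m i + 0 ≤ (B - A).toNat := fun i => by
    have := hω i
    rw [hωAB] at this
    exact_mod_cast this
  have hmem : ∀ v : S, ((j v : ℝ), (k v : ℝ)) ∈ Δ' := fun v => by
    have h1 : (j v : ℝ) = u.1 * (v.1 0 : ℝ) + u.2 * (v.1 1 : ℝ) + -A := by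
      exact_mod_cast (hjS v v.2).1
    have h2 : (k v : ℝ) = w.1 * (v.1 0 : ℝ) + w.2 * (v.1 1 : ℝ) + -A' := by
      exact_mod_cast hkS v v.2
    rw [h1, h2]
    exact hmem' _ ((hS v).1 v.2)
  obtain ⟨σ, hσm, hσ, hσvol⟩ := exists_le_volume_of_kernel_vector hη hη0
    (j := fun v : S => j v) (k := fun v : S => k v) hinj (Nat.zero_le _)
    (fun v => ⟨Nat.zero_le _, (hjS v v.2).2⟩) hmω hcA hcB hconv' hmeas' hmem
    (fun i a b hab => by
      have := hc ⟨i, ⟨a, by omega⟩, ⟨b, by omega⟩⟩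
      simpa only [if_pos hab] using this)
  refine ⟨σ, hσm, ?_, hvol ▸ hσvol⟩
  rw [hωAB]
  exact_mod_cast hσ

/-- If over an infinite field `F`, for every choice of `n` points there is a
curve with Newton polygon `Δ` (with `ω(Δ) ≥ max mᵢ`) passing through them with multiplicities
`mᵢ`, then `area(Δ) ≥ ½·Σ mᵢ² − ½·max{Σ sᵢ² : 0 ≤ sᵢ ≤ mᵢ, Σ sᵢ ≤ ω(Δ)}`. -/
theorem statement0 (F : Type*) [Field F] [Infinite F]
    (n : ℕ) (hn : 1 ≤ n) (m : Fin n → ℕ) (hm : ∀ i, 1 ≤ m i)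
    (Δ : Set (ℝ × ℝ)) (hΔ : IsLatticePolygon Δ)
    (hω : ∀ i, (m i : ℝ) ≤ minLatticeWidth Δ)
    (hcurve : ∀ p : Fin n → F × F, ∃ Cf : MvPolynomial (Fin 2) F,
      Cf ≠ 0 ∧ newtonPolygon Cf = Δ ∧ ∀ i, multAtLeast (p i) (m i) Cf) :
    (MeasureTheory.volume Δ).toReal ≥
      (1 / 2) * (∑ i, (m i : ℝ) ^ 2) -
        (1 / 2) * sSup { t : ℝ | ∃ s : Fin n → ℕ, (∀ i, s i ≤ m i) ∧
          ((∑ i, (s i : ℝ)) ≤ minLatticeWidth Δ) ∧ t = ∑ i, (s i : ℝ) ^ 2 } := by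
  obtain ⟨s, hsm, hsω, hvol⟩ := exists_le_volume_of_isLatticePolygon hΔ hω fun p =>
    (hcurve p).imp fun f hf => hf.2
  have hfin : MeasureTheory.volume Δ ≠ ⊤ := by
    obtain ⟨⟨V, hV⟩, -⟩ := hΔ
    rw [hV]
    exact ((V.finite_toSet.image _).isCompact_convexHull ℝ).measure_ne_top
  have harea := (ENNReal.ofReal_le_iff_le_toReal hfin).1 hvol
  have hbdd : BddAbove { t : ℝ | ∃ s : Fin n → ℕ, (∀ i, s i ≤ m i) ∧
      ((∑ i, (s i : ℝ)) ≤ minLatticeWidth Δ) ∧ t = ∑ i, (s i : ℝ) ^ 2 } := by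
    refine ⟨∑ i, (m i : ℝ) ^ 2, ?_⟩
    rintro t ⟨s, hs, -, rfl⟩
    gcongr with i
    exact hs i
  have := le_csSup hbdd ⟨s, hsm, hsω, rfl⟩
  linarith
end

section
/- Let F be an infinite field, n ≥ 1, and let m be a positive integer. Let Δ ⊂ ℝ² be a convex lattice polygon with minimal lattice width ω(Δ) ≥ m. Suppose that for every choice of n points p₁,…,pₙ ∈ F² there exists a nonzero polynomial C ∈ F[x,y] whose Newton polygon equals Δ and such that μ_{pᵢ}(C) ≥ m for every i = 1,…,n. Then area(Δ) ≥ ½·(n − ω(Δ)/m − 1)·m², where ω(Δ)/m is computed in ℝ. -/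
open MvPolynomial

open MeasureTheory in
theorem volume_level_eq_zero {I : Set ℝ} {g : ℝ → ℝ} (hg : ConcaveOn ℝ I g) {c z : ℝ}
    (hz : z ∈ I) (hcz : c < g z) : volume {x ∈ I | g x = c} = 0 := by
  have aux : ∀ p ∈ I, ∀ q ∈ I, g p = c → g q = c → q ∈ openSegment ℝ p z → False := by
    rintro p hp q hq hpc hqc ⟨s, t, hs, ht, hst, rfl⟩
    have := hg.2 hp hz hs.le ht.le hst
    simp only [smul_eq_mul] at this hqc
    have e : s = 1 - t := by linarith
    subst e
    rw [hqc, hpc] at this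
    nlinarith
  have hsub : {x ∈ I | g x = c} ⊆
      {x ∈ I | g x = c ∧ x < z} ∪ {x ∈ I | g x = c ∧ z < x} := by
    rintro x ⟨hx, hxc⟩
    rcases lt_trichotomy x z with h | h | h
    · exact Or.inl ⟨hx, hxc, h⟩
    · subst h; linarith
    · exact Or.inr ⟨hx, hxc, h⟩
  refine measure_mono_null hsub (measure_union_null ?_ ?_)
  · refine Set.Subsingleton.measure_zero ?_ _
    rintro p ⟨hp, hpc, hpz⟩ q ⟨hq, hqc, hqz⟩
    by_contra hne
    rcases lt_or_gt_of_ne hne with h | h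
    · exact aux p hp q hq hpc hqc (by rw [openSegment_eq_Ioo (by linarith)]; exact ⟨h, hqz⟩)
    · exact aux q hq p hp hqc hpc (by rw [openSegment_eq_Ioo (by linarith)]; exact ⟨h, hpz⟩)
  · refine Set.Subsingleton.measure_zero ?_ _
    rintro p ⟨hp, hpc, hpz⟩ q ⟨hq, hqc, hqz⟩
    by_contra hne
    rcases lt_or_gt_of_ne hne with h | h
    · exact aux q hq p hp hqc hpc
        (by rw [openSegment_symm, openSegment_eq_Ioo (by linarith)]; exact ⟨hpz, h⟩)
    · exact aux p hp q hq hpc hqc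
        (by rw [openSegment_symm, openSegment_eq_Ioo (by linarith)]; exact ⟨hqz, h⟩)

open MeasureTheory in
theorem measurableSet_superlevel {I : Set ℝ} {g : ℝ → ℝ} (hg : ConcaveOn ℝ I g) (c : ℝ) :
    MeasurableSet {x ∈ I | c ≤ g x} :=
  (hg.convex_ge c).ordConnected.measurableSet

open MeasureTheory in
theorem le_volume_superlevel_volume_le {a b : ℝ} {g : ℝ → ℝ}
    (hg : ConcaveOn ℝ (Set.Icc a b) g) {v : ENNReal}
    (hs : volume {x ∈ Set.Icc a b | ∀ y ∈ Set.Icc a b, g y ≤ g x} < v)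
    (hv : v ≤ volume (Set.Icc a b)) :
    v ≤ volume {x ∈ Set.Icc a b | volume {y ∈ Set.Icc a b | g x ≤ g y} ≤ v} := by
  set I := Set.Icc a b with hI
  set φ : ℝ → ENNReal := fun x => volume {y ∈ I | g x ≤ g y} with hφ
  have hanti : ∀ x y, g x ≤ g y → φ y ≤ φ x := fun x y h =>
    measure_mono fun z hz => ⟨hz.1, h.trans hz.2⟩
  change v ≤ volume {x ∈ I | φ x ≤ v}
  set C := {x ∈ I | v < φ x} with hC
  have hsup : ∀ x ∈ I, (∀ y ∈ C, g y < g x) → x ∈ {x ∈ I | φ x ≤ v} := fun x hx h =>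
    ⟨hx, not_lt.1 fun h' => (h x ⟨hx, h'⟩).false⟩
  rcases C.eq_empty_or_nonempty with hCe | hCne
  · refine hv.trans (measure_mono fun x hx => hsup x hx ?_)
    simp [hCe]
  by_cases hatt : ∃ x ∈ C, ∀ y ∈ C, g y ≤ g x
  · obtain ⟨x, hx, hmax⟩ := hatt
    have hz : ∃ z ∈ I, g x < g z := by
      by_contra! hcon
      have : φ x = volume {x ∈ I | ∀ y ∈ I, g y ≤ g x} := by
        refine congrArg volume (Set.ext fun y => ?_)
        constructor
        · exact fun h => ⟨h.1, fun z hz => (hcon z hz).trans h.2⟩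
        · exact fun h => ⟨h.1, h.2 x hx.1⟩
      exact (hx.2.trans_le (this.le.trans hs.le)).false
    obtain ⟨z, hz, hxz⟩ := hz
    have h0 := volume_level_eq_zero hg hz hxz
    calc v ≤ φ x := hx.2.le
      _ ≤ volume ({x ∈ I | φ x ≤ v} ∪ {y ∈ I | g y = g x}) := by
          refine measure_mono fun y hy => ?_
          rcases eq_or_lt_of_le hy.2 with h | h
          · exact Or.inr ⟨hy.1, h.symm⟩
          · exact Or.inl (hsup y hy.1 fun w hw => (hmax w hw).trans_lt h)
      _ ≤ _ := (measure_union_le _ _).trans (by rw [h0, add_zero])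
  · push Not at hatt
    have hbdd : BddAbove (g '' C) := by
      by_contra hb
      rw [not_bddAbove_iff] at hb
      obtain ⟨x, hx⟩ := hCne
      have : {x ∈ I | ∀ y ∈ I, g y ≤ g x} ⊆ I := fun x hx => hx.1
      have hI0 : a ≤ b := hx.1.1.trans hx.1.2
      set p := (a + b) / 2
      have hp : p ∈ I := ⟨by simp only [p]; linarith, by simp only [p]; linarith⟩
      obtain ⟨_, ⟨y, hy, rfl⟩, hy'⟩ := hb (2 * g p - min (g a) (g b))
      have hr : a + b - y ∈ I := ⟨by linarith [hy.1.2], by linarith [hy.1.1]⟩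
      have h1 := hg.2 hy.1 hr (show (0 : ℝ) ≤ 1 / 2 by norm_num)
        (show (0 : ℝ) ≤ 1 / 2 by norm_num) (by norm_num)
      have h2 := hg.min_le_of_mem_Icc (Set.left_mem_Icc.2 hI0) (Set.right_mem_Icc.2 hI0) hr
      simp only [smul_eq_mul] at h1
      rw [show 1 / 2 * y + 1 / 2 * (a + b - y) = p by simp only [p]; ring] at h1
      linarith
    obtain ⟨u, hu, hlim, hmem⟩ := exists_seq_tendsto_sSup (hCne.image g) hbdd
    choose x hxC hxu using hmem
    have hle : ∀ k, u k ≤ sSup (g '' C) := fun k => le_csSup hbdd ⟨x k, hxC k, hxu k⟩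
    have hmono : Antitone fun k => {y ∈ I | u k ≤ g y} := fun i j h y hy =>
      ⟨hy.1, (hu h).trans hy.2⟩
    have hsub : (⋂ k, {y ∈ I | u k ≤ g y}) ⊆ {x ∈ I | φ x ≤ v} := by
      intro y hy
      rw [Set.mem_iInter] at hy
      refine hsup y (hy 0).1 fun w hw => ?_
      obtain ⟨w', hw', hlt⟩ := hatt w hw
      exact hlt.trans_le ((le_csSup hbdd ⟨w', hw', rfl⟩).trans
        (le_of_tendsto' hlim fun k => (hy k).2))
    refine le_trans ?_ (measure_mono hsub)
    rw [hmono.measure_iInter (fun k => (measurableSet_superlevel hg _).nullMeasurableSet)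
      ⟨0, ((measure_mono fun y hy => hy.1).trans_lt
        (show volume I < ⊤ from measure_Icc_lt_top)).ne⟩]
    refine le_iInf fun k => ?_
    have := (hxC k).2.le
    simp only [hφ, hxu] at this
    exact this

open MeasureTheory in
theorem le_lintegral_sub_volume_superlevel {a b m : ℝ} {g : ℝ → ℝ}
    (hg : ConcaveOn ℝ (Set.Icc a b) g) (hm : 0 ≤ m) (hmab : m ≤ b - a) :
    ENNReal.ofReal ((m ^ 2 -
        m * volume.real {x ∈ Set.Icc a b | ∀ y ∈ Set.Icc a b, g y ≤ g x}) / 2) ≤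
      ∫⁻ x in Set.Icc a b,
        ENNReal.ofReal (m - volume.real {y ∈ Set.Icc a b | g x ≤ g y}) := by
  set I := Set.Icc a b with hI
  have hIfin : ∀ p : ℝ → Prop, volume {x ∈ I | p x} ≠ ⊤ := fun p =>
    ((measure_mono fun y hy => hy.1).trans_lt
        (show volume I < ⊤ from measure_Icc_lt_top)).ne
  set s := volume.real {x ∈ I | ∀ y ∈ I, g y ≤ g x} with hs
  have hs0 : 0 ≤ s := measureReal_nonneg
  rcases le_or_gt m s with hms | hsm
  · rw [ENNReal.ofReal_of_nonpos (by nlinarith)]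
    exact zero_le
  set φ : ℝ → ℝ := fun x => volume.real {y ∈ I | g x ≤ g y} with hφ
  have hanti : ∀ x y, g x ≤ g y → φ y ≤ φ x := fun x y h =>
    measureReal_mono (fun z hz => ⟨hz.1, h.trans hz.2⟩) (hIfin _)
  set f : ℝ → ℝ := fun x => max 0 (m - φ x) with hf
  have hfm : AEMeasurable f (volume.restrict I) := by
    refine (aemeasurable_indicator_iff measurableSet_Icc).1 (Measurable.aemeasurable ?_)
    refine measurable_of_Ici fun t => ?_
    rcases le_or_gt t 0 with ht | ht
    · convert MeasurableSet.univ
      ext x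
      simp only [Set.mem_preimage, Set.mem_Ici, Set.mem_univ, iff_true]
      exact ht.trans (Set.indicator_nonneg (fun _ _ => le_max_left _ _) _)
    · have : (I.indicator f) ⁻¹' Set.Ici t = {x ∈ I | φ x ≤ m - t} := by
        ext x
        by_cases hx : x ∈ I
        · simp [hx, hf, ht.not_ge]
          constructor <;> intro <;> linarith
        · simp [hx, ht]
      rw [this]
      refine Set.OrdConnected.measurableSet ⟨?_⟩
      rintro x ⟨hx, hxt⟩ y ⟨hy, hyt⟩ z hz
      refine ⟨Set.ordConnected_Icc.out hx hy hz, ?_⟩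
      have := hg.min_le_of_mem_Icc hx hy hz
      rcases min_le_iff.1 this with h | h
      · exact (hanti _ _ h).trans hxt
      · exact (hanti _ _ h).trans hyt
  have h1 : ∀ x, ENNReal.ofReal (m - φ x) = ENNReal.ofReal (f x) := fun x => by
    rcases le_total 0 (m - φ x) with h | h
    · rw [hf]; simp only [max_eq_right h]
    · rw [hf]; simp only [max_eq_left h, ENNReal.ofReal_of_nonpos h, ENNReal.ofReal_zero]
  simp_rw [show ∀ x, volume.real {y ∈ I | g x ≤ g y} = φ x from fun _ => rfl, h1]
  rw [lintegral_eq_lintegral_meas_le _ (f := f)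
    (Filter.Eventually.of_forall fun x => le_max_left _ _) hfm]
  calc ENNReal.ofReal ((m ^ 2 - m * s) / 2)
      ≤ ENNReal.ofReal (∫ t in (0 : ℝ)..(m - s), (m - t)) := by
        refine ENNReal.ofReal_le_ofReal ?_
        rw [intervalIntegral.integral_sub intervalIntegrable_const
          (continuous_id'.intervalIntegrable _ _), intervalIntegral.integral_const, integral_id,
          smul_eq_mul]
        nlinarith
    _ = ∫⁻ t in Set.Ioc 0 (m - s), ENNReal.ofReal (m - t) := by
        rw [intervalIntegral.integral_of_le (by linarith), ofReal_integral_eq_lintegral_ofReal]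
        · exact (continuous_const.sub continuous_id).integrableOn_Ioc
        · refine (ae_restrict_iff' measurableSet_Ioc).2 (Filter.Eventually.of_forall ?_)
          intro t ht
          simp only [Pi.zero_apply]
          linarith [ht.2]
    _ = ∫⁻ t in Set.Ioo 0 (m - s), ENNReal.ofReal (m - t) := by
        rw [setLIntegral_congr Ioo_ae_eq_Ioc]
    _ ≤ ∫⁻ t in Set.Ioo 0 (m - s), (volume.restrict I) {x | t ≤ f x} := by
        refine setLIntegral_mono' measurableSet_Ioo fun t ht => ?_
        have h2 : ENNReal.ofReal (m - t) ≤
            volume {x ∈ I | volume {y ∈ I | g x ≤ g y} ≤ ENNReal.ofReal (m - t)} := by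
          refine le_volume_superlevel_volume_le hg ?_ ?_
          · rw [ENNReal.lt_ofReal_iff_toReal_lt (hIfin _)]
            change s < m - t
            linarith [ht.2]
          · rw [Real.volume_Icc]
            exact ENNReal.ofReal_le_ofReal (by linarith [ht.1])
        refine h2.trans ((measure_mono ?_).trans (Measure.le_restrict_apply _ _))
        rintro x ⟨hx, hx'⟩
        refine ⟨?_, hx⟩
        rw [ENNReal.le_ofReal_iff_toReal_le (hIfin _) (by linarith [ht.2])] at hx'
        change φ x ≤ m - t at hx'
        show t ≤ max 0 (m - φ x)
        exact le_max_of_le_right (by linarith)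
    _ ≤ _ := lintegral_mono_set fun t ht => ht.1
theorem exists_concaveOn_hull (S : Finset ℝ) (hS : S.Nonempty) (ν : ℝ → ℝ) :
    ∃ V : ℝ → ℝ, ConcaveOn ℝ (Set.Icc (S.min' hS) (S.max' hS)) V ∧ (∀ i ∈ S, ν i ≤ V i) ∧
      ∀ x ∈ Set.Icc (S.min' hS) (S.max' hS), ∃ i ∈ S, ∃ j ∈ S, ∃ t ∈ Set.Icc (0 : ℝ) 1,
        x = (1 - t) * i + t * j ∧ V x = (1 - t) * ν i + t * ν j := by
  have key : ∀ x ∈ Set.Icc (S.min' hS) (S.max' hS), ∃ v : ℝ,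
      (∃ i ∈ S, ∃ j ∈ S, ∃ t ∈ Set.Icc (0 : ℝ) 1,
        x = (1 - t) * i + t * j ∧ v = (1 - t) * ν i + t * ν j) ∧
      (x ∈ S → ν x ≤ v) ∧
      (x ∈ Set.Ioo (S.min' hS) (S.max' hS) → ∃ b : ℝ, ∀ i ∈ S, ν i ≤ v + b * (i - x)) := by
    intro x hx
    let P : Finset (ℝ × ℝ) := (S ×ˢ S).filter fun p => p.1 ≤ x ∧ x ≤ p.2
    let f : ℝ × ℝ → ℝ := fun p =>
      (1 - (x - p.1) / (p.2 - p.1)) * ν p.1 + (x - p.1) / (p.2 - p.1) * ν p.2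
    have hP : P.Nonempty := ⟨(S.min' hS, S.max' hS), by
      simp [P, S.min'_mem hS, S.max'_mem hS, hx.1, hx.2]⟩
    obtain ⟨p, hp, hmax⟩ := P.exists_max_image f hP
    have hself : x ∈ S → ν x ≤ f p := fun h => by
      have := hmax (x, x) (by simp [P, h])
      simpa [f] using this
    simp only [P, Finset.mem_filter, Finset.mem_product] at hp
    obtain ⟨⟨h1, h2⟩, h3, h4⟩ := hp
    refine ⟨f p, ⟨p.1, h1, p.2, h2, (x - p.1) / (p.2 - p.1), ⟨?_, ?_⟩, ?_, rfl⟩, hself, ?_⟩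
    · exact div_nonneg (by linarith) (by linarith)
    · exact div_le_one_of_le₀ (by linarith) (by linarith)
    · rcases eq_or_lt_of_le (h3.trans h4) with h | h
      · have : x = p.1 := by linarith
        simp [← h, this]
      · have : p.2 - p.1 ≠ 0 := by linarith
        field_simp
        ring
    · intro hxo
      have hR : (S.filter fun i => x < i).Nonempty :=
        ⟨S.max' hS, by simp [S.max'_mem hS]; simpa using hxo.2⟩
      obtain ⟨r, hr, hrmax⟩ := Finset.exists_max_image _ (fun i => (ν i - f p) / (i - x)) hR
      simp only [Finset.mem_filter] at hr hrmax
      refine ⟨(ν r - f p) / (r - x), fun i hi => ?_⟩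
      rcases lt_trichotomy i x with h | h | h
      · have hc := hmax (i, r) (by simp [P, hi, hr.1, h.le, hr.2.le])
        have e1 : f (i, r) = (ν i * (r - x) + ν r * (x - i)) / (r - i) := by
          have : r - i ≠ 0 := by linarith [hr.2]
          simp only [f]; field_simp; ring
        rw [e1, div_le_iff₀ (by linarith [hr.2])] at hc
        have h5 : 0 < r - x := by linarith [hr.2]
        have : f p + (ν r - f p) / (r - x) * (i - x) =
            (f p * (r - x) + (ν r - f p) * (i - x)) / (r - x) := by field_simp
        rw [this, le_div_iff₀ h5]
        linarith
      · subst h; simpa using hself hi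
      · have := hrmax i ⟨hi, h⟩
        rw [div_le_iff₀ (by linarith)] at this
        linarith
  choose! V hV using key
  have hline : ∀ x ∈ Set.Ioo (S.min' hS) (S.max' hS), ∃ b : ℝ,
      ∀ y ∈ Set.Icc (S.min' hS) (S.max' hS), V y ≤ V x + b * (y - x) := by
    intro x hx
    obtain ⟨b, hb⟩ := (hV x (Set.Ioo_subset_Icc_self hx)).2.2 hx
    refine ⟨b, fun y hy => ?_⟩
    obtain ⟨i, hi, j, hj, t, ht, hyt, hv⟩ := (hV y hy).1
    rw [hv, hyt]
    nlinarith [mul_le_mul_of_nonneg_left (hb i hi) (sub_nonneg.2 ht.2),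
      mul_le_mul_of_nonneg_left (hb j hj) ht.1]
  refine ⟨V, LinearOrder.concaveOn_of_lt (convex_Icc _ _) ?_, fun i hi =>
    (hV i ⟨S.min'_le i hi, S.le_max' i hi⟩).2.1 hi, fun x hx => (hV x hx).1⟩
  intro x hx y hy hxy a b ha hb hab
  have hz : a • x + b • y ∈ Set.Ioo (S.min' hS) (S.max' hS) := by
    have : a = 1 - b := by linarith
    subst this
    simp only [smul_eq_mul]
    constructor
    · nlinarith [hx.1, mul_pos hb (sub_pos.2 hxy)]
    · nlinarith [hy.2, mul_pos ha (sub_pos.2 hxy)]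
  obtain ⟨c, hc⟩ := hline _ hz
  have h1 := mul_le_mul_of_nonneg_left (hc x hx) ha.le
  have h2 := mul_le_mul_of_nonneg_left (hc y hy) hb.le
  have : a = 1 - b := by linarith
  subst this
  simp only [smul_eq_mul] at *
  linarith

open MeasureTheory in
theorem sum_volume_argmax_le {n : ℕ} {a b : ℝ} {V : ℝ → ℝ}
    (hV : ∀ c : ℝ, ConcaveOn ℝ (Set.Icc a b) fun x => V x + c * x) (hab : a ≤ b) {c : Fin n → ℝ}
    (hc : Function.Injective c) :
    ∑ k, volume.real {x ∈ Set.Icc a b | ∀ y ∈ Set.Icc a b, V y + c k * y ≤ V x + c k * x} ≤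
      b - a := by
  set P : Fin n → Set ℝ :=
    fun k => {x ∈ Set.Icc a b | ∀ y ∈ Set.Icc a b, V y + c k * y ≤ V x + c k * x} with hP
  have hPsub : ∀ k, P k ⊆ Set.Icc a b := fun k x hx => hx.1
  have hPfin : ∀ k, volume (P k) ≠ ⊤ := fun k =>
    ((measure_mono (hPsub k)).trans_lt measure_Icc_lt_top).ne
  have hPm : ∀ k, MeasurableSet (P k) := by
    refine fun k => Set.OrdConnected.measurableSet ⟨?_⟩
    rintro x ⟨hx, hx'⟩ y ⟨hy, hy'⟩ z hz
    refine ⟨Set.ordConnected_Icc.out hx hy hz, fun w hw => ?_⟩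
    have := (hV (c k)).min_le_of_mem_Icc hx hy hz
    rcases min_le_iff.1 this with h | h
    · exact (hx' w hw).trans h
    · exact (hy' w hw).trans h
  have hdisj : Pairwise (Function.onFun (AEDisjoint volume) P) := by
    intro k l hkl
    refine Set.Subsingleton.measure_zero ?_ _
    rintro x ⟨hx, hx'⟩ y ⟨hy, hy'⟩
    have h1 := hx.2 y hy.1
    have h2 := hy.2 x hx.1
    have h3 := hx'.2 y hy.1
    have h4 := hy'.2 x hx.1
    have : (c k - c l) * (x - y) = 0 := by linarith
    rcases mul_eq_zero.1 this with h | h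
    · exact absurd (hc (sub_eq_zero.1 h)) hkl
    · exact sub_eq_zero.1 h
  change ∑ k, (volume (P k)).toReal ≤ b - a
  rw [← ENNReal.toReal_sum fun k _ => hPfin k]
  refine ENNReal.toReal_le_of_le_ofReal (by linarith) ?_
  rw [← Real.volume_Icc, ← tsum_fintype (L := .unconditional _),
    ← measure_iUnion₀ hdisj fun k => (hPm k).nullMeasurableSet]
  exact measure_mono (Set.iUnion_subset hPsub)

open MeasureTheory in
theorem sum_lintegral_le {α ι : Type*} [MeasurableSpace α] (μ : Measure α) (s : Finset ι)
    (f : ι → α → ENNReal) : ∑ k ∈ s, ∫⁻ x, f k x ∂μ ≤ ∫⁻ x, ∑ k ∈ s, f k x ∂μ := by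
  classical
  induction s using Finset.induction_on with
  | empty => simp
  | insert k s hk ih =>
    simp only [Finset.sum_insert hk]
    exact (add_le_add le_rfl ih).trans (le_lintegral_add _ _)

open MeasureTheory in
/-- A lower bound for the area of a convex set in terms of its vertical chords over finitely many
abscissae, each chord being at least as long as required by the superlevel sets of the tilted
functions `ν + c k * x`. -/
theorem le_volume_of_chords {n : ℕ} (S : Finset ℝ) (hS : S.Nonempty) (ν : ℝ → ℝ) (c : Fin n → ℝ)
    (hc : Function.Injective c) {m : ℝ} (hm : 0 ≤ m) (hmS : m ≤ S.max' hS - S.min' hS)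
    {D : Set (ℝ × ℝ)} (hD : Convex ℝ D) (hDm : MeasurableSet D)
    (h : ∀ i ∈ S, ∃ y z, (i, y) ∈ D ∧ (i, z) ∈ D ∧ ∃ e : Fin n → ℝ, (∀ k, 0 ≤ e k) ∧
      ∑ k, e k ≤ z - y ∧ ∀ k, ∃ i₁ ∈ S, ∃ i₂ ∈ S, ν i + c k * i ≤ ν i₁ + c k * i₁ ∧
        ν i + c k * i ≤ ν i₂ + c k * i₂ ∧ m ≤ e k + (i₂ - i₁)) :
    ENNReal.ofReal ((n * m ^ 2 - m * (S.max' hS - S.min' hS)) / 2) ≤ volume D := by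
  obtain ⟨V, hVc, hVS, hVr⟩ := exists_concaveOn_hull S hS ν
  set a := S.min' hS
  set b := S.max' hS
  have hSI : ∀ i ∈ S, i ∈ Set.Icc a b := fun i hi => ⟨S.min'_le i hi, S.le_max' i hi⟩
  have hV : ∀ d : ℝ, ConcaveOn ℝ (Set.Icc a b) fun x => V x + d * x := fun d =>
    hVc.add ((LinearMap.mulLeft ℝ d).concaveOn (convex_Icc a b))
  set φ : Fin n → ℝ → ℝ :=
    fun k x => volume.real {y ∈ Set.Icc a b | V x + c k * x ≤ V y + c k * y} with hφ
  have hfin : ∀ p : ℝ → Prop, volume {x ∈ Set.Icc a b | p x} ≠ ⊤ := fun p =>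
    ((measure_mono fun y hy => hy.1).trans_lt
        (show volume (Set.Icc a b) < ⊤ from measure_Icc_lt_top)).ne
  have hpt : ∀ x ∈ Set.Icc a b,
      ∑ k, ENNReal.ofReal (m - φ k x) ≤ volume (Prod.mk x ⁻¹' D) := by
    intro x hx
    obtain ⟨i, hi, j, hj, t, ⟨ht0, ht1⟩, hxt, hVx⟩ := hVr x hx
    obtain ⟨y, z, hy, hz, e, he0, hesum, he⟩ := h i hi
    obtain ⟨y', z', hy', hz', e', he0', hesum', he'⟩ := h j hj
    have hsub : Set.Icc ((1 - t) * y + t * y') ((1 - t) * z + t * z') ⊆ Prod.mk x ⁻¹' D := by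
      have h1 := hD hy hy' (sub_nonneg.2 ht1) ht0 (by ring)
      have h2 := hD hz hz' (sub_nonneg.2 ht1) ht0 (by ring)
      simp only [Prod.smul_mk, Prod.mk_add_mk, smul_eq_mul, ← hxt] at h1 h2
      have hconv : Convex ℝ (Prod.mk x ⁻¹' D) := by
        intro p hp q hq α β hα hβ hαβ
        have := hD hp hq hα hβ hαβ
        simp only [Prod.smul_mk, Prod.mk_add_mk, smul_eq_mul, ← add_mul, hαβ, one_mul] at this
        exact this
      exact hconv.ordConnected.out h1 h2
    refine le_trans ?_ (measure_mono hsub)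
    rw [Real.volume_Icc]
    have hk : ∀ k, ENNReal.ofReal (m - φ k x) ≤ ENNReal.ofReal ((1 - t) * e k + t * e' k) := by
      refine fun k => ENNReal.ofReal_le_ofReal ?_
      obtain ⟨i₁, hi₁, i₂, hi₂, hν₁, hν₂, hle⟩ := he k
      obtain ⟨j₁, hj₁, j₂, hj₂, hμ₁, hμ₂, hle'⟩ := he' k
      have hlev : ∀ p ∈ S, ∀ q ∈ S, ν i + c k * i ≤ ν p + c k * p →
          ν j + c k * j ≤ ν q + c k * q → (1 - t) * p + t * q ∈
            {w ∈ Set.Icc a b | V x + c k * x ≤ V w + c k * w} := by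
        intro p hp q hq hpi hqj
        have h1 := hVc.2 (hSI p hp) (hSI q hq) (sub_nonneg.2 ht1) ht0 (by ring)
        refine ⟨convex_Icc a b (hSI p hp) (hSI q hq) (sub_nonneg.2 ht1) ht0 (by ring), ?_⟩
        simp only [smul_eq_mul] at h1
        rw [hVx, hxt]
        nlinarith [mul_le_mul_of_nonneg_left (hVS p hp) (sub_nonneg.2 ht1),
          mul_le_mul_of_nonneg_left (hVS q hq) ht0,
          mul_le_mul_of_nonneg_left hpi (sub_nonneg.2 ht1),
          mul_le_mul_of_nonneg_left hqj ht0]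
      have hα := hlev _ hi₁ _ hj₁ hν₁ hμ₁
      have hβ := hlev _ hi₂ _ hj₂ hν₂ hμ₂
      have hlen : ((1 - t) * i₂ + t * j₂) - ((1 - t) * i₁ + t * j₁) ≤ φ k x := by
        have h1 := measureReal_mono (((hV (c k)).convex_ge _).ordConnected.out hα hβ) (hfin _)
        rw [Measure.real, Real.volume_Icc] at h1
        exact (le_max_left _ _).trans (ENNReal.toReal_ofReal'.symm.le.trans h1)
      nlinarith [mul_le_mul_of_nonneg_left hle (sub_nonneg.2 ht1),
        mul_le_mul_of_nonneg_left hle' ht0]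
    calc ∑ k, ENNReal.ofReal (m - φ k x)
        ≤ ∑ k, ENNReal.ofReal ((1 - t) * e k + t * e' k) := Finset.sum_le_sum fun k _ => hk k
      _ = ENNReal.ofReal (∑ k, ((1 - t) * e k + t * e' k)) :=
          (ENNReal.ofReal_sum_of_nonneg fun k _ => add_nonneg
            (mul_nonneg (sub_nonneg.2 ht1) (he0 k)) (mul_nonneg ht0 (he0' k))).symm
      _ ≤ _ := by
          refine ENNReal.ofReal_le_ofReal ?_
          rw [Finset.sum_add_distrib, ← Finset.mul_sum, ← Finset.mul_sum]
          nlinarith [mul_le_mul_of_nonneg_left hesum (sub_nonneg.2 ht1),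
            mul_le_mul_of_nonneg_left hesum' ht0]
  have hsum := sum_volume_argmax_le hV (by linarith) hc
  set s : Fin n → ℝ := fun k =>
    volume.real {x ∈ Set.Icc a b | ∀ y ∈ Set.Icc a b, V y + c k * y ≤ V x + c k * x}
  calc ENNReal.ofReal ((n * m ^ 2 - m * (b - a)) / 2)
      ≤ ENNReal.ofReal (∑ k, (m ^ 2 - m * s k) / 2) := by
        refine ENNReal.ofReal_le_ofReal ?_
        rw [← Finset.sum_div, Finset.sum_sub_distrib, ← Finset.mul_sum]
        simp only [Finset.sum_const, Finset.card_univ, Fintype.card_fin, nsmul_eq_mul]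
        have := mul_le_mul_of_nonneg_left hsum hm
        linarith
    _ ≤ ∑ k, ENNReal.ofReal ((m ^ 2 - m * s k) / 2) :=
        Finset.le_sum_of_subadditive _ ENNReal.ofReal_zero.le
          (fun _ _ => ENNReal.ofReal_add_le) _ _
    _ ≤ ∑ k, ∫⁻ x in Set.Icc a b, ENNReal.ofReal (m - φ k x) :=
        Finset.sum_le_sum fun k _ => le_lintegral_sub_volume_superlevel (hV (c k)) hm hmS
    _ ≤ ∫⁻ x in Set.Icc a b, ∑ k, ENNReal.ofReal (m - φ k x) := sum_lintegral_le _ _ _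
    _ ≤ ∫⁻ x in Set.Icc a b, volume (Prod.mk x ⁻¹' D) :=
        setLIntegral_mono' measurableSet_Icc hpt
    _ ≤ ∫⁻ x, volume (Prod.mk x ⁻¹' D) := setLIntegral_le_lintegral _ _
    _ = volume D := by rw [Measure.volume_eq_prod, Measure.prod_apply hDm]

theorem natTrailingDegree_add_natDegree_le_of_dvd {F : Type*} [Field F] {g q : Polynomial F}
    (hg : g ≠ 0) (hq : q ∣ g) (h0 : q.coeff 0 ≠ 0) :
    g.natTrailingDegree + q.natDegree ≤ g.natDegree := by
  obtain ⟨r, rfl⟩ := hq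
  have hq0 := left_ne_zero_of_mul hg
  have hr0 := right_ne_zero_of_mul hg
  rw [Polynomial.natTrailingDegree_mul hq0 hr0, Polynomial.natDegree_mul hq0 hr0,
    Nat.le_zero.1 (Polynomial.natTrailingDegree_le_of_ne_zero h0)]
  have := r.natTrailingDegree_le_natDegree
  omega

theorem X_sub_C_pow_dvd_iff_hasseDeriv {F : Type*} [Field F] {g : Polynomial F} {t : F} {M : ℕ} :
    (Polynomial.X - Polynomial.C t) ^ M ∣ g ↔
      ∀ j < M, (Polynomial.hasseDeriv j g).eval t = 0 := by
  rw [Polynomial.X_sub_C_pow_dvd_iff, Polynomial.X_pow_dvd_iff]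
  simp_rw [← Polynomial.taylor_coeff, Polynomial.taylor_apply]

theorem exists_hasseDeriv_ne_zero {F : Type*} [Field F] {g : Polynomial F} (hg : g ≠ 0) (t : F) :
    ∃ j, (Polynomial.X - Polynomial.C t) ^ j ∣ g ∧ (Polynomial.hasseDeriv j g).eval t ≠ 0 := by
  refine ⟨(Polynomial.taylor t g).natTrailingDegree,
    X_sub_C_pow_dvd_iff_hasseDeriv.2 fun j hj => ?_, ?_⟩
  · rw [← Polynomial.taylor_coeff]
    exact Polynomial.coeff_eq_zero_of_lt_natTrailingDegree hj
  · rw [← Polynomial.taylor_coeff]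
    exact Polynomial.trailingCoeff_nonzero_iff_nonzero.2 (by simpa using hg)

theorem eval_hasseDeriv_sum {F ι : Type*} [Field F] (s : Finset ι) (b : ι → F) (d : ι → ℕ)
    (j : ℕ) (t : F) :
    t ^ j * (Polynomial.hasseDeriv j (∑ i ∈ s, Polynomial.monomial (d i) (b i))).eval t =
      ∑ i ∈ s, b i * ((d i).choose j * t ^ d i) := by
  simp only [map_sum, Polynomial.hasseDeriv_monomial, Polynomial.eval_finsetSum,
    Polynomial.eval_monomial, Finset.mul_sum]
  refine Finset.sum_congr rfl fun i _ => ?_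
  rcases lt_or_ge (d i) j with h | h
  · simp [Nat.choose_eq_zero_of_lt h]
  · rw [← Nat.sub_add_cancel h, pow_add, Nat.add_sub_cancel]
    ring

/-- If a family of coefficients `a e ∈ F[T]` defines a polynomial with points of multiplicity `m`
at `(T ^ k, η k)`, then any convex set containing its exponents has large area. -/
theorem le_volume_of_multiplicity {F : Type*} [Field F] {n m : ℕ} (E : Finset (ℕ × ℕ))
    (a : ℕ × ℕ → Polynomial F) (ha : ∀ e ∈ E, a e ≠ 0) {η : Fin n → F}
    (hη : Function.Injective η) (hη0 : ∀ k, η k ≠ 0)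
    (hmult : ∀ k : Fin n, ∀ α β : ℕ, α + β < m → ∑ e ∈ E, a e *
      (Polynomial.C (e.1.choose α * (e.2.choose β * η k ^ e.2)) *
        Polynomial.X ^ ((k : ℕ) * e.1)) = 0)
    {l r : ℕ} (hl : ∃ e ∈ E, e.1 = l) (hr : ∃ e ∈ E, e.1 = r)
    (hE : ∀ e ∈ E, l ≤ e.1 ∧ e.1 ≤ r) (hmlr : m + l ≤ r)
    {D : Set (ℝ × ℝ)} (hD : Convex ℝ D) (hDm : MeasurableSet D)
    (hED : ∀ e ∈ E, ((e.1 : ℝ), (e.2 : ℝ)) ∈ D) :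
    ENNReal.ofReal ((n * (m : ℝ) ^ 2 - m * ((r : ℝ) - l)) / 2) ≤ MeasureTheory.volume D := by
  classical
  let N : ℕ → ℕ := fun i => (E.filter fun e => e.1 = i).sup fun e => (a e).natDegree
  have hN : ∀ e ∈ E, (a e).natDegree ≤ N e.1 := fun e he =>
    Finset.le_sup (f := fun e => (a e).natDegree) (by simp [he])
  let S : Finset ℝ := E.image fun e => (e.1 : ℝ)
  have hS : S.Nonempty := by
    obtain ⟨e, he, -⟩ := hl
    exact ⟨_, Finset.mem_image_of_mem _ he⟩
  have hSmem : ∀ e ∈ E, (e.1 : ℝ) ∈ S := fun e he => Finset.mem_image_of_mem _ he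
  have hmin : S.min' hS = l := by
    obtain ⟨e, he, rfl⟩ := hl
    refine le_antisymm (S.min'_le _ (hSmem e he)) (S.le_min' _ _ fun y hy => ?_)
    obtain ⟨e', he', rfl⟩ := Finset.mem_image.1 hy
    exact_mod_cast (hE e' he').1
  have hmax : S.max' hS = r := by
    obtain ⟨e, he, rfl⟩ := hr
    refine le_antisymm (S.max'_le _ _ fun y hy => ?_) (S.le_max' _ (hSmem e he))
    obtain ⟨e', he', rfl⟩ := Finset.mem_image.1 hy
    exact_mod_cast (hE e' he').2
  rw [← hmin, ← hmax]
  refine le_volume_of_chords S hS (fun x => N ⌊x⌋₊) (fun k => ((k : ℕ) : ℝ))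
    (fun k l h => Fin.ext (Nat.cast_injective h)) (Nat.cast_nonneg m) ?_ hD hDm ?_
  · rw [hmin, hmax, le_sub_iff_add_le]
    exact_mod_cast hmlr
  intro x hx
  obtain ⟨e₀, he₀, rfl⟩ := Finset.mem_image.1 hx
  set i := e₀.1 with hi
  let B : Finset (ℕ × ℕ) := E.filter fun e => e.1 = i
  have hBE : ∀ e ∈ B, e ∈ E ∧ e.1 = i := fun e he => Finset.mem_filter.1 he
  let g : Polynomial F := ∑ e ∈ B, Polynomial.monomial e.2 ((a e).coeff (N i))
  have hgcoeff : ∀ j, g.coeff j ≠ 0 → (i, j) ∈ E := by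
    intro j hj
    simp only [g, Polynomial.finsetSum_coeff, Polynomial.coeff_monomial] at hj
    obtain ⟨e, he, hne⟩ := Finset.exists_ne_zero_of_sum_ne_zero hj
    have : e.2 = j := by
      by_contra h
      simp [h] at hne
    rw [← this, ← (hBE e he).2]
    exact (hBE e he).1
  have hg : g ≠ 0 := by
    obtain ⟨e, he, hsup⟩ := Finset.exists_mem_eq_sup B ⟨e₀, by simp [B, he₀, hi]⟩
      fun e => (a e).natDegree
    intro h
    have h1 : g.coeff e.2 = (a e).coeff (N i) := by
      simp only [g, Polynomial.finsetSum_coeff, Polynomial.coeff_monomial]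
      rw [Finset.sum_eq_single e]
      · simp
      · intro e' he' hne
        rw [if_neg]
        exact fun h2 => hne (Prod.ext ((hBE e' he').2.trans (hBE e he).2.symm) h2)
      · exact fun h => absurd he h
    rw [h, Polynomial.coeff_zero, show N i = (a e).natDegree from hsup] at h1
    exact ha e (hBE e he).1 (Polynomial.leadingCoeff_eq_zero.1 h1.symm)
  choose j hjdvd hjne using fun k => exists_hasseDeriv_ne_zero hg (η k)
  have hsum : g.natTrailingDegree + ∑ k, j k ≤ g.natDegree := by
    have h1 : (∏ k, (Polynomial.X - Polynomial.C (η k)) ^ j k) ∣ g :=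
      Finset.prod_dvd_of_coprime (fun k _ l _ hkl =>
        (Polynomial.pairwise_coprime_X_sub_C hη hkl).pow) fun k _ => hjdvd k
    have h2 := natTrailingDegree_add_natDegree_le_of_dvd hg h1 (by
      rw [Polynomial.coeff_zero_eq_eval_zero, Polynomial.eval_prod]
      refine Finset.prod_ne_zero_iff.2 fun k _ => ?_
      simp [hη0 k])
    rwa [Polynomial.natDegree_prod_of_monic _ _
      fun k _ => (Polynomial.monic_X_sub_C _).pow _, Finset.sum_congr rfl fun k _ => by
        rw [Polynomial.natDegree_pow, Polynomial.natDegree_X_sub_C, mul_one]] at h2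
  refine ⟨g.natTrailingDegree, g.natDegree, ?_, ?_, fun k => j k, fun k => Nat.cast_nonneg _,
    ?_, fun k => ?_⟩
  · exact hED _ (hgcoeff _ (Polynomial.trailingCoeff_nonzero_iff_nonzero.2 hg))
  · exact hED _ (hgcoeff _ (Polynomial.leadingCoeff_ne_zero.2 hg))
  · rw [le_sub_iff_add_le']
    beta_reduce
    exact_mod_cast hsum
  rcases le_or_gt m (j k) with hmj | hjm
  · refine ⟨i, hx, i, hx, le_rfl, le_rfl, ?_⟩
    rw [sub_self, add_zero]
    beta_reduce
    exact_mod_cast hmj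
  let b : ℕ → Polynomial F := fun i' => ∑ e ∈ E with e.1 = i',
    a e * Polynomial.C ((e.2.choose (j k) : F) * η k ^ e.2)
  let I : Finset ℕ := E.image Prod.fst
  have hbi : (b i).coeff (N i) ≠ 0 := by
    have : (b i).coeff (N i) = η k ^ j k * (Polynomial.hasseDeriv (j k) g).eval (η k) := by
      rw [eval_hasseDeriv_sum]
      simp only [b, B, Polynomial.finsetSum_coeff, Polynomial.coeff_mul_C]
    rw [this]
    exact mul_ne_zero (pow_ne_zero _ (hη0 k)) (hjne k)
  have hbi0 : b i ≠ 0 := fun h => hbi (by rw [h, Polynomial.coeff_zero])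
  obtain ⟨p, hp, hpmax⟩ := Finset.exists_max_image (I.filter fun i' => b i' ≠ 0)
    (fun i' => (b i').natDegree + k * i')
    ⟨i, by simp only [Finset.mem_filter]; exact ⟨Finset.mem_image_of_mem _ he₀, hbi0⟩⟩
  set w := (b p).natDegree + k * p with hw
  have hwi : N i + k * i ≤ w := by
    have h1 := hpmax i (by
      simp only [Finset.mem_filter]; exact ⟨Finset.mem_image_of_mem _ he₀, hbi0⟩)
    have h2 := Polynomial.le_natDegree_of_ne_zero hbi
    omega
  let h : Polynomial F := ∑ i' ∈ I, Polynomial.monomial i' ((b i').coeff (w - k * i'))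
  have hcoeff : ∀ i', h.coeff i' = if i' ∈ I then (b i').coeff (w - k * i') else 0 := by
    intro i'
    simp [h, Polynomial.coeff_monomial]
  have hle : ∀ i' ∈ I, b i' ≠ 0 → k * i' ≤ w := fun i' hi' hb => by
    have := hpmax i' (by simp only [Finset.mem_filter]; exact ⟨hi', hb⟩)
    omega
  have hh : h ≠ 0 := by
    intro h0
    rw [Finset.mem_filter] at hp
    have h1 := hcoeff p
    rw [h0, if_pos hp.1, Polynomial.coeff_zero, hw, Nat.add_sub_cancel] at h1
    exact hp.2 (Polynomial.leadingCoeff_eq_zero.1 h1.symm)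
  have hlev : ∀ i', h.coeff i' ≠ 0 → (i' : ℝ) ∈ S ∧ N i + k * i ≤ N i' + k * i' := by
    intro i' hi'
    rw [hcoeff] at hi'
    have hI : i' ∈ I := by
      by_contra h1
      exact hi' (if_neg h1)
    rw [if_pos hI] at hi'
    have hb : b i' ≠ 0 := fun h1 => hi' (by rw [h1, Polynomial.coeff_zero])
    have h1 := hle i' hI hb
    simp only [b, Polynomial.finsetSum_coeff, Polynomial.coeff_mul_C] at hi'
    obtain ⟨e, he, hne⟩ := Finset.exists_ne_zero_of_sum_ne_zero hi'
    obtain ⟨heE, rfl⟩ := Finset.mem_filter.1 he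
    have h2 := Polynomial.le_natDegree_of_ne_zero (left_ne_zero_of_mul hne)
    have h3 := hN e heE
    exact ⟨hSmem e heE, by omega⟩
  have hdvd : (Polynomial.X - Polynomial.C 1) ^ (m - j k) ∣ h := by
    refine X_sub_C_pow_dvd_iff_hasseDeriv.2 fun α hα => ?_
    have h1 := eval_hasseDeriv_sum I (fun i' => (b i').coeff (w - k * i')) id α 1
    simp only [one_pow, one_mul, mul_one, id] at h1
    change (Polynomial.hasseDeriv α h).eval 1 = _ at h1
    rw [h1]
    have h2 := congrArg (fun q => Polynomial.coeff q w) (hmult k α (j k) (by omega))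
    rw [← Finset.sum_fiberwise_of_maps_to (t := I) (g := Prod.fst)
      fun e he => Finset.mem_image_of_mem _ he] at h2
    simp only [Polynomial.finsetSum_coeff, Polynomial.coeff_zero] at h2
    rw [← h2]
    refine Finset.sum_congr rfl fun i' hi' => ?_
    have h3 : (b i').coeff (w - k * i') = (b i' * Polynomial.X ^ ((k : ℕ) * i')).coeff w := by
      rw [Polynomial.coeff_mul_X_pow']
      split_ifs with h4
      · rfl
      · have : b i' = 0 := by
          by_contra h5
          exact h4 (hle i' hi' h5)
        rw [this, Polynomial.coeff_zero]
    rw [h3, ← Polynomial.coeff_mul_C, ← Polynomial.finsetSum_coeff]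
    congr 1
    simp only [b, Finset.sum_mul]
    refine Finset.sum_congr rfl fun e he => ?_
    obtain ⟨-, rfl⟩ := Finset.mem_filter.1 he
    simp only [map_mul]
    ring
  have hspread := natTrailingDegree_add_natDegree_le_of_dvd hh hdvd (by
    rw [Polynomial.coeff_zero_eq_eval_zero]; simp)
  rw [Polynomial.natDegree_pow, Polynomial.natDegree_X_sub_C, mul_one] at hspread
  obtain ⟨hS₁, hlev₁⟩ := hlev _ (Polynomial.trailingCoeff_nonzero_iff_nonzero.2 hh)
  obtain ⟨hS₂, hlev₂⟩ := hlev _ (Polynomial.leadingCoeff_ne_zero.2 hh)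
  refine ⟨_, hS₁, _, hS₂, ?_, ?_, ?_⟩
  · simp only [Nat.floor_natCast]
    exact_mod_cast hlev₁
  · simp only [Nat.floor_natCast]
    exact_mod_cast hlev₂
  · have : m + h.natTrailingDegree ≤ j k + h.natDegree := by omega
    have : (m : ℝ) + h.natTrailingDegree ≤ j k + h.natDegree := by exact_mod_cast this
    linarith

theorem aeval_eq_zero_of_multAtLeast {F Q : Type*} [Field F] [CommRing Q] [Algebra F Q]
    {J : Ideal Q} {m : ℕ} (hJ : J ^ m = ⊥) {p : F × F} {f : MvPolynomial (Fin 2) F}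
    (hf : multAtLeast p m f) {x y : Q} (hx : x - algebraMap F Q p.1 ∈ J)
    (hy : y - algebraMap F Q p.2 ∈ J) : aeval ![x, y] f = 0 := by
  have h : aeval ![x, y] f ∈ J ^ m := by
    have h1 := Ideal.mem_map_of_mem (aeval ![x, y] : MvPolynomial (Fin 2) F →ₐ[F] Q) hf
    rw [Ideal.map_pow, Ideal.map_span] at h1
    refine Ideal.pow_right_mono (Ideal.span_le.2 ?_) m h1
    rintro _ ⟨z, rfl | rfl, rfl⟩
    · simpa using hx
    · simpa using hy
  simpa [hJ] using h

theorem units_zpow_mul_zpow_sub_mem {F Q : Type*} [Field F] [CommRing Q] [Algebra F Q]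
    {J : Ideal Q} {s t : Qˣ} {ξ η : Fˣ} (hs : (s : Q) - algebraMap F Q ξ ∈ J)
    (ht : (t : Q) - algebraMap F Q η ∈ J) (a b : ℤ) :
    ((s ^ a * t ^ b : Qˣ) : Q) - algebraMap F Q ((ξ ^ a * η ^ b : Fˣ) : F) ∈ J := by
  let q : Q →* (Q ⧸ J) := (Ideal.Quotient.mk J : Q →* Q ⧸ J)
  let c : F →* Q := (algebraMap F Q : F →* Q)
  have hs' : Units.map q s = Units.map q (Units.map c ξ) := Units.ext (Ideal.Quotient.eq.2 hs)
  have ht' : Units.map q t = Units.map q (Units.map c η) := Units.ext (Ideal.Quotient.eq.2 ht)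
  have h : Units.map q (s ^ a * t ^ b) = Units.map q (Units.map c (ξ ^ a * η ^ b)) := by
    simp only [map_mul, map_zpow, hs', ht']
  exact Ideal.Quotient.eq.1 (congrArg Units.val h)

theorem sum_smul_units_eq_zero {F Q : Type*} [Field F] [CommRing Q] [Algebra F Q]
    {J : Ideal Q} {m : ℕ} (hJ : J ^ m = ⊥) {s t : Qˣ} {ξ η : Fˣ} {u v : ℤ × ℤ}
    {f : MvPolynomial (Fin 2) F}
    (hf : multAtLeast (((ξ ^ u.1 * η ^ v.1 : Fˣ) : F), ((ξ ^ u.2 * η ^ v.2 : Fˣ) : F)) m f)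
    (hs : (s : Q) - algebraMap F Q ξ ∈ J) (ht : (t : Q) - algebraMap F Q η ∈ J)
    {A B : ℤ} {i j : (Fin 2 →₀ ℕ) → ℕ}
    (hi : ∀ e ∈ f.support, (i e : ℤ) = u.1 * e 0 + u.2 * e 1 + A)
    (hj : ∀ e ∈ f.support, (j e : ℤ) = v.1 * e 0 + v.2 * e 1 + B) :
    ∑ e ∈ f.support, algebraMap F Q (coeff e f) * ((s : Q) ^ i e * (t : Q) ^ j e) = 0 := by
  have h2 := congrArg (fun z => z * ((s ^ A * t ^ B : Qˣ) : Q))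
    (aeval_eq_zero_of_multAtLeast hJ hf (units_zpow_mul_zpow_sub_mem hs ht _ _)
      (units_zpow_mul_zpow_sub_mem hs ht _ _))
  simp only [zero_mul, aeval_def, eval₂_eq', Finset.sum_mul] at h2
  rw [← h2]
  refine Finset.sum_congr rfl fun e he => ?_
  rw [Fin.prod_univ_two, mul_assoc]
  refine congrArg₂ (· * ·) rfl ?_
  simp only [Matrix.cons_val_zero, Matrix.cons_val_one]
  norm_cast
  rw [← zpow_natCast s, ← zpow_natCast t, hi e he, hj e he]
  simp only [← zpow_natCast, mul_zpow, ← zpow_mul, zpow_add]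
  simp only [mul_comm, mul_left_comm, mul_assoc]

theorem coeff_one_add_X_pow_mul {F : Type*} [CommRing F] (i j α β : ℕ) :
    coeff (Finsupp.single 0 α + Finsupp.single 1 β)
      ((1 + X 0 : MvPolynomial (Fin 2) F) ^ i * (1 + X 1 : MvPolynomial (Fin 2) F) ^ j) =
      i.choose α * j.choose β := by
  classical
  have h (k : Fin 2) (N : ℕ) : (1 + X k : MvPolynomial (Fin 2) F) ^ N =
      ∑ a ∈ Finset.range (N + 1), monomial (Finsupp.single k a) (N.choose a : F) := by
    rw [add_comm, add_pow]
    refine Finset.sum_congr rfl fun a _ => ?_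
    rw [one_pow, mul_one, X_pow_eq_monomial, ← map_natCast (C : F →+* MvPolynomial (Fin 2) F), mul_comm, C_mul_monomial, mul_one]
  have hinj (a b : ℕ) : (Finsupp.single 0 a + Finsupp.single 1 b : Fin 2 →₀ ℕ) =
      (Finsupp.single 0 α + Finsupp.single 1 β : Fin 2 →₀ ℕ) ↔ a = α ∧ b = β := by
    refine ⟨fun h => ⟨by simpa using DFunLike.congr_fun h 0, by simpa using DFunLike.congr_fun h 1⟩,
      ?_⟩
    rintro ⟨rfl, rfl⟩
    rfl
  simp only [h, Finset.sum_mul_sum, monomial_mul, coeff_sum, coeff_monomial, hinj, ite_and]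
  simp only [Finset.sum_ite_eq', Finset.sum_ite_irrel, Finset.sum_const_zero, Finset.mem_range,
    Nat.lt_succ_iff]
  split_ifs with h1 h2
  · rfl
  · simp [Nat.choose_eq_zero_of_lt (not_le.1 h2)]
  · simp [Nat.choose_eq_zero_of_lt (not_le.1 h1)]

theorem sum_coeff_eq_zero_of_multAtLeast {F : Type*} [Field F] {m : ℕ} (ξ η : Fˣ) {u v : ℤ × ℤ}
    {f : MvPolynomial (Fin 2) F}
    (hf : multAtLeast (((ξ ^ u.1 * η ^ v.1 : Fˣ) : F), ((ξ ^ u.2 * η ^ v.2 : Fˣ) : F)) m f)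
    {A B : ℤ} {i j : (Fin 2 →₀ ℕ) → ℕ}
    (hi : ∀ e ∈ f.support, (i e : ℤ) = u.1 * e 0 + u.2 * e 1 + A)
    (hj : ∀ e ∈ f.support, (j e : ℤ) = v.1 * e 0 + v.2 * e 1 + B) {α β : ℕ} (hαβ : α + β < m) :
    ∑ e ∈ f.support, coeff e f *
      ((i e).choose α * ((j e).choose β * (η : F) ^ j e) * (ξ : F) ^ i e) = 0 := by
  let I := idealOfVars (Fin 2) F
  let mk := Ideal.Quotient.mk (I ^ m)
  let J : Ideal (MvPolynomial (Fin 2) F ⧸ I ^ m) := I.map mk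
  have hJ : J ^ m = ⊥ := by rw [← Ideal.map_pow, Ideal.map_quotient_self]
  have hXI (k : Fin 2) : X k ∈ I := Ideal.subset_span (Set.mem_range_self k)
  have hunit (k : Fin 2) (ζ : Fˣ) : IsUnit (mk (C (ζ : F) * (1 + X k))) := by
    rw [map_mul, map_add, map_one]
    refine ((ζ.isUnit.map C).map mk).mul (IsNilpotent.isUnit_one_add ⟨m, ?_⟩)
    rw [← map_pow]
    exact Ideal.Quotient.eq_zero_iff_mem.2 (Ideal.pow_mem_pow (hXI k) m)
  have hmem (k : Fin 2) (ζ : Fˣ) : mk (C (ζ : F) * (1 + X k)) - algebraMap F _ (ζ : F) ∈ J := by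
    have : mk (C (ζ : F) * (1 + X k)) - algebraMap F _ (ζ : F) = mk (C (ζ : F) * X k) := by
      rw [mul_add, mul_one, map_add, add_sub_right_comm]
      exact add_eq_right.2 (sub_self _)
    rw [this]
    exact Ideal.mem_map_of_mem _ (I.mul_mem_left _ (hXI k))
  obtain ⟨s, hs⟩ := hunit 0 ξ
  obtain ⟨t, ht⟩ := hunit 1 η
  have hs' := hmem 0 ξ
  have ht' := hmem 1 η
  rw [← hs] at hs'
  rw [← ht] at ht'
  have h0 := sum_smul_units_eq_zero hJ hf hs' ht' hi hj
  have h1 : mk (∑ e ∈ f.support, C (coeff e f) *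
      ((C (ξ : F) * (1 + X 0)) ^ i e * (C (η : F) * (1 + X 1)) ^ j e)) = 0 := by
    rw [← h0, map_sum]
    refine Finset.sum_congr rfl fun e he => ?_
    rw [map_mul, map_mul, map_pow, map_pow, ← hs, ← ht]
    rfl
  have h2 := (mem_pow_idealOfVars_iff' m _).1 (Ideal.Quotient.eq_zero_iff_mem.1 h1)
    (Finsupp.single 0 α + Finsupp.single 1 β) (by simpa using hαβ)
  rw [coeff_sum] at h2
  rw [← h2]
  refine Finset.sum_congr rfl fun e _ => ?_
  have : C (coeff e f) * ((C (ξ : F) * (1 + X 0)) ^ i e * (C (η : F) * (1 + X 1)) ^ j e) =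
      C (coeff e f * (ξ : F) ^ i e * (η : F) ^ j e) *
        ((1 + X 0 : MvPolynomial (Fin 2) F) ^ i e * (1 + X 1) ^ j e) := by
    simp only [mul_pow, map_mul, map_pow]
    ring
  rw [this, coeff_C_mul, coeff_one_add_X_pow_mul]
  ring

theorem exists_polynomial_solution {F E κ : Type*} [Field F] [Infinite F] [Fintype E] [Fintype κ]
    (M : κ → E → Polynomial F) (P : E → Prop)
    (h : ∀ τ : F, τ ≠ 0 → ∃ a : E → F, (∃ e, P e ∧ a e ≠ 0) ∧
      ∀ k, ∑ e, a e * (M k e).eval τ = 0) :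
    ∃ a : E → Polynomial F, (∃ e, P e ∧ a e ≠ 0) ∧ ∀ k, ∑ e, a e * M k e = 0 := by
  classical
  by_contra! hcon
  let L := FractionRing (Polynomial F)
  let ι := algebraMap (Polynomial F) L
  have hι : Function.Injective ι := IsFractionRing.injective _ _
  let row : κ → (E → L) →ₗ[L] L := fun k => ∑ e, ι (M k e) • LinearMap.proj e
  have hrow (k : κ) (x : E → L) : row k x = ∑ e, x e * ι (M k e) := by
    simp [row, mul_comm]
  have hker (e₀ : E) (he₀ : P e₀) : ∃ d : Polynomial F, d ≠ 0 ∧ ∃ c : κ → Polynomial F,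
      ∀ e, ∑ k, c k * M k e = if e = e₀ then d else 0 := by
    have hmem : (LinearMap.proj e₀ : (E → L) →ₗ[L] L) ∈ Submodule.span L (Set.range row) := by
      refine mem_span_of_iInf_ker_le_ker fun x hx => ?_
      obtain ⟨b, hb⟩ := IsLocalization.exist_integer_multiples_of_finite
        (nonZeroDivisors (Polynomial F)) x
      choose y hy using hb
      simp only [Algebra.smul_def] at hy
      have hb0 : ι b ≠ 0 := (map_ne_zero_iff ι hι).2 (nonZeroDivisors.ne_zero b.2)
      by_contra h0
      obtain ⟨k, hk⟩ := hcon y ⟨e₀, he₀, fun h1 => h0 (by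
        have := hy e₀
        rw [h1, map_zero] at this
        exact (mul_eq_zero.1 this.symm).resolve_left hb0)⟩
      refine hk (hι ?_)
      have hxk : row k x = 0 := (Submodule.mem_iInf _).1 hx k
      rw [map_sum, map_zero, ← mul_zero (ι b), ← hxk, hrow, Finset.mul_sum]
      refine Finset.sum_congr rfl fun e _ => ?_
      rw [map_mul, hy e, mul_assoc]
    obtain ⟨c, hc⟩ := (Submodule.mem_span_range_iff_exists_fun L).1 hmem
    obtain ⟨b, hb⟩ := IsLocalization.exist_integer_multiples_of_finite
      (nonZeroDivisors (Polynomial F)) c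
    choose y hy using hb
    simp only [Algebra.smul_def] at hy
    refine ⟨b, nonZeroDivisors.ne_zero b.2, y, fun e => hι ?_⟩
    have h1 := congrArg (fun φ : (E → L) →ₗ[L] L => φ (Pi.single e 1)) hc
    simp only [LinearMap.sum_apply, LinearMap.smul_apply, hrow, smul_eq_mul, Pi.single_apply,
      LinearMap.proj_apply, ite_mul, one_mul, zero_mul, Finset.sum_ite_eq', Finset.mem_univ,
      if_true] at h1
    have h2 : ι b * _ = ι b * _ := congrArg (ι b * ·) h1
    rw [Finset.mul_sum] at h2
    rw [map_sum]
    convert h2 using 1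
    · refine Finset.sum_congr rfl fun k _ => ?_
      rw [map_mul, hy k, mul_assoc]
    · rw [apply_ite ι, map_zero]
      simp [eq_comm]
  choose! d hd c hc using hker
  obtain ⟨τ, hτ⟩ : ∃ τ : F, (Polynomial.X * ∏ e with P e, d e).eval τ ≠ 0 := by
    by_contra! h0
    have h1 : Polynomial.X * ∏ e with P e, d e = 0 := Polynomial.funext fun τ => by
      rw [h0, Polynomial.eval_zero]
    refine mul_ne_zero Polynomial.X_ne_zero (Finset.prod_ne_zero_iff.2 fun e he => ?_) h1
    exact hd e (Finset.mem_filter.1 he).2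
  rw [Polynomial.eval_mul, Polynomial.eval_X, Polynomial.eval_prod] at hτ
  obtain ⟨a, ⟨e₀, he₀, hae₀⟩, ha⟩ := h τ (left_ne_zero_of_mul hτ)
  have hdτ : (d e₀).eval τ ≠ 0 :=
    Finset.prod_ne_zero_iff.1 (right_ne_zero_of_mul hτ) e₀ (by simp [he₀])
  refine mul_ne_zero hae₀ hdτ ?_
  have h1 : ∑ k, (c e₀ k).eval τ * ∑ e, a e * (M k e).eval τ = 0 := by simp [ha]
  rw [← h1]
  simp only [Finset.mul_sum]
  rw [Finset.sum_comm]
  have h2 (e : E) : ∑ k, (c e₀ k).eval τ * (a e * (M k e).eval τ) =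
      a e * (if e = e₀ then d e₀ else 0 : Polynomial F).eval τ := by
    rw [← hc e₀ he₀ e, Polynomial.eval_finsetSum, Finset.mul_sum]
    refine Finset.sum_congr rfl fun k _ => ?_
    rw [Polynomial.eval_mul]
    ring
  simp only [h2]
  rw [Finset.sum_eq_single e₀]
  · rw [if_pos rfl]
  · intro e _ hne
    rw [if_neg hne, Polynomial.eval_zero, mul_zero]
  · simp

theorem exists_polynomial_solution_pair {F E κ : Type*} [Field F] [Infinite F] [Fintype E]
    [Fintype κ] (M : κ → E → Polynomial F) (P Q : E → Prop)
    (h : ∀ τ : F, τ ≠ 0 → ∃ a : E → F, (∃ e, P e ∧ a e ≠ 0) ∧ (∃ e, Q e ∧ a e ≠ 0) ∧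
      ∀ k, ∑ e, a e * (M k e).eval τ = 0) :
    ∃ a : E → Polynomial F, (∃ e, P e ∧ a e ≠ 0) ∧ (∃ e, Q e ∧ a e ≠ 0) ∧
      ∀ k, ∑ e, a e * M k e = 0 := by
  obtain ⟨a, haP, ha⟩ := exists_polynomial_solution M P fun τ hτ =>
    (h τ hτ).imp fun a ha => ⟨ha.1, ha.2.2⟩
  obtain ⟨b, hbQ, hb⟩ := exists_polynomial_solution M Q fun τ hτ =>
    (h τ hτ).imp fun a ha => ha.2
  by_cases haQ : ∃ e, Q e ∧ a e ≠ 0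
  · exact ⟨a, haP, haQ, ha⟩
  by_cases hbP : ∃ e, P e ∧ b e ≠ 0
  · exact ⟨b, hbP, hbQ, hb⟩
  push Not at haQ hbP
  refine ⟨a + b, ?_, ?_, fun k => ?_⟩
  · obtain ⟨e, he, h0⟩ := haP
    exact ⟨e, he, by simpa [hbP e he] using h0⟩
  · obtain ⟨e, he, h0⟩ := hbQ
    exact ⟨e, he, by simpa [haQ e he] using h0⟩
  · simp [add_mul, Finset.sum_add_distrib, ha k, hb k]

theorem volume_image_unimodular {u v : ℤ × ℤ} (huv : u.1 * v.2 - u.2 * v.1 = 1) (A B : ℤ)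
    {s : Set (ℝ × ℝ)} (hs : IsCompact s) (hc : Convex ℝ s) :
    ∃ D : Set (ℝ × ℝ), MeasureTheory.volume D = MeasureTheory.volume s ∧ Convex ℝ D ∧
      MeasurableSet D ∧ ∀ x ∈ s, (u.1 * x.1 + u.2 * x.2 + A, v.1 * x.1 + v.2 * x.2 + B) ∈ D := by
  let L : (ℝ × ℝ) →ₗ[ℝ] ℝ × ℝ := Matrix.toLin (Module.Basis.finTwoProd ℝ) (Module.Basis.finTwoProd ℝ)
    !![(u.1 : ℝ), (u.2 : ℝ); (v.1 : ℝ), (v.2 : ℝ)]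
  have hL (x : ℝ × ℝ) : L x = (u.1 * x.1 + u.2 * x.2, v.1 * x.1 + v.2 * x.2) :=
    Matrix.toLin_finTwoProd_apply _ _ _ _ x
  have hdet : LinearMap.det L = 1 := by
    rw [LinearMap.det_toLin, Matrix.det_fin_two_of]
    exact_mod_cast huv
  have hLc : Continuous L := L.continuous_of_finiteDimensional
  refine ⟨(fun x => x + ((A : ℝ), (B : ℝ))) '' (L '' s), ?_, ?_, ?_, fun x hx => ?_⟩
  · rw [Set.image_add_right, MeasureTheory.measure_preimage_add_right,
      MeasureTheory.Measure.addHaar_image_linearMap, hdet]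
    simp
  · simpa only [add_comm] using (hc.linear_image L).translate ((A : ℝ), (B : ℝ))
  · exact ((hs.image hLc).image (continuous_id.add continuous_const)).measurableSet
  · exact ⟨L x, ⟨x, hx, rfl⟩, by simp [hL]⟩

/-- The point of `ℝ²` corresponding to an exponent vector. -/
def exponentPoint (d : Fin 2 →₀ ℕ) : ℝ × ℝ := ((d 0 : ℝ), (d 1 : ℝ))

theorem exponentPoint_mem_newtonPolygon {K : Type*} [CommRing K] {f : MvPolynomial (Fin 2) K}
    {e : Fin 2 →₀ ℕ} (he : e ∈ f.support) : exponentPoint e ∈ newtonPolygon f :=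
  subset_convexHull ℝ _ ⟨e, he, rfl⟩

theorem isCompact_newtonPolygon {K : Type*} [CommRing K] (f : MvPolynomial (Fin 2) K) :
    IsCompact (newtonPolygon f) :=
  (f.support.finite_toSet.image _).isCompact_convexHull ℝ

theorem exists_mem_support_le {K : Type*} [CommRing K] {f : MvPolynomial (Fin 2) K} (hf : f ≠ 0)
    (a b : ℝ) : ∃ e ∈ f.support, ∀ x ∈ newtonPolygon f,
      a * x.1 + b * x.2 ≤ a * (exponentPoint e).1 + b * (exponentPoint e).2 := by
  obtain ⟨e, he, hmax⟩ := f.support.exists_max_image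
    (fun e => a * (exponentPoint e).1 + b * (exponentPoint e).2) (support_nonempty.2 hf)
  refine ⟨e, he, fun x hx => ?_⟩
  have hconv : Convex ℝ {x : ℝ × ℝ |
      a * x.1 + b * x.2 ≤ a * (exponentPoint e).1 + b * (exponentPoint e).2} :=
    convex_halfSpace_le (f := fun x : ℝ × ℝ => a * x.1 + b * x.2)
      ⟨fun x y => by simp only [Prod.fst_add, Prod.snd_add]; ring,
        fun c x => by simp only [Prod.smul_fst, Prod.smul_snd, smul_eq_mul]; ring⟩ _
  refine convexHull_min ?_ hconv hx
  rintro _ ⟨d, hd, rfl⟩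
  exact hmax d hd

theorem isGreatest_latticeWidth {Δ : Set (ℝ × ℝ)} (hΔ : IsCompact Δ) (hne : Δ.Nonempty)
    (u : ℤ × ℤ) : IsGreatest
      {w : ℝ | ∃ x ∈ Δ, ∃ y ∈ Δ, w = u.1 * (x.1 - y.1) + u.2 * (x.2 - y.2)}
      (latticeWidth u Δ) := by
  have h : {w : ℝ | ∃ x ∈ Δ, ∃ y ∈ Δ, w = u.1 * (x.1 - y.1) + u.2 * (x.2 - y.2)} =
      (fun p : (ℝ × ℝ) × (ℝ × ℝ) => (u.1 : ℝ) * (p.1.1 - p.2.1) + u.2 * (p.1.2 - p.2.2)) ''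
        Δ ×ˢ Δ := by
    ext w
    constructor
    · rintro ⟨x, hx, y, hy, rfl⟩
      exact ⟨(x, y), ⟨hx, hy⟩, rfl⟩
    · rintro ⟨⟨x, y⟩, ⟨hx, hy⟩, rfl⟩
      exact ⟨x, hx, y, hy, rfl⟩
  rw [latticeWidth, h]
  exact ((hΔ.prod hΔ).image (by fun_prop)).isGreatest_sSup ((hne.prod hne).image _)

theorem latticeWidth_nonneg {Δ : Set (ℝ × ℝ)} (hΔ : IsCompact Δ) (hne : Δ.Nonempty)
    (u : ℤ × ℤ) : 0 ≤ latticeWidth u Δ := by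
  obtain ⟨x, hx⟩ := hne
  exact (isGreatest_latticeWidth hΔ ⟨x, hx⟩ u).2 ⟨x, hx, x, hx, by simp⟩

theorem latticeWidth_le_of_mul {Δ : Set (ℝ × ℝ)} (hΔ : IsCompact Δ) (hne : Δ.Nonempty)
    (u : ℤ × ℤ) {g : ℕ} (hg : 0 < g) :
    latticeWidth u Δ ≤ latticeWidth (u.1 * g, u.2 * g) Δ := by
  obtain ⟨x, hx, y, hy, h⟩ := (isGreatest_latticeWidth hΔ hne u).1
  have h1 := (isGreatest_latticeWidth hΔ hne (u.1 * g, u.2 * g)).2 ⟨x, hx, y, hy, rfl⟩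
  have h2 : (1 : ℝ) ≤ g := by exact_mod_cast hg
  have h3 := latticeWidth_nonneg hΔ hne u
  push_cast at h1
  nlinarith

theorem finite_exponents_of_isCompact {Δ : Set (ℝ × ℝ)} (hΔ : IsCompact Δ) :
    {e : Fin 2 →₀ ℕ | exponentPoint e ∈ Δ}.Finite := by
  obtain ⟨R, hR⟩ := hΔ.isBounded.exists_norm_le
  refine (Set.finite_Iic (Finsupp.equivFunOnFinite.symm fun _ : Fin 2 => ⌊R⌋₊)).subset
    fun e he => ?_
  have h := norm_prod_le_iff.1 (hR _ he)
  simp only [exponentPoint, Real.norm_natCast] at h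
  intro k
  rw [Finsupp.equivFunOnFinite_symm_apply_apply]
  fin_cases k
  · exact Nat.le_floor h.1
  · exact Nat.le_floor h.2

theorem le_volume_of_det_eq_one {F : Type*} [Field F] [Infinite F] {n m : ℕ}
    {Δ : Set (ℝ × ℝ)} {u v : ℤ × ℤ} (huv : u.1 * v.2 - u.2 * v.1 = 1)
    (hω : (m : ℝ) ≤ latticeWidth u Δ)
    (hcurve : ∀ p : Fin n → F × F, ∃ Cf : MvPolynomial (Fin 2) F,
      Cf ≠ 0 ∧ newtonPolygon Cf = Δ ∧ ∀ i, multAtLeast (p i) m Cf) :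
    ENNReal.ofReal ((n * (m : ℝ) ^ 2 - m * latticeWidth u Δ) / 2) ≤ MeasureTheory.volume Δ := by
  classical
  obtain ⟨f₀, hf₀, hΔ₀, -⟩ := hcurve fun _ => 0
  have hcomp : IsCompact Δ := hΔ₀ ▸ isCompact_newtonPolygon f₀
  have hconv : Convex ℝ Δ := hΔ₀ ▸ convex_convexHull ℝ _
  obtain ⟨e₁, he₁, hmin⟩ := exists_mem_support_le hf₀ (-u.1 : ℝ) (-u.2)
  obtain ⟨e₂, he₂, hmax⟩ := exists_mem_support_le hf₀ (u.1 : ℝ) u.2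
  obtain ⟨e₃, he₃, hbot⟩ := exists_mem_support_le hf₀ (-v.1 : ℝ) (-v.2)
  replace he₁ := exponentPoint_mem_newtonPolygon he₁
  replace he₂ := exponentPoint_mem_newtonPolygon he₂
  rw [hΔ₀] at hmin hmax hbot he₁ he₂
  simp only [exponentPoint] at hmin hmax hbot
  let U : (Fin 2 →₀ ℕ) → ℤ := fun e => u.1 * e 0 + u.2 * e 1 - (u.1 * e₁ 0 + u.2 * e₁ 1)
  let V : (Fin 2 →₀ ℕ) → ℤ := fun e => v.1 * e 0 + v.2 * e 1 - (v.1 * e₃ 0 + v.2 * e₃ 1)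
  have hU (e) (he : exponentPoint e ∈ Δ) : 0 ≤ U e := by
    have := hmin _ he
    simp only [exponentPoint] at this
    rify [U]
    linarith
  have hV (e) (he : exponentPoint e ∈ Δ) : 0 ≤ V e := by
    have := hbot _ he
    simp only [exponentPoint] at this
    rify [V]
    linarith
  have hUcast (e) (he : exponentPoint e ∈ Δ) : ((U e).toNat : ℝ) = U e := by
    exact_mod_cast congrArg (Int.cast : ℤ → ℝ) (Int.toNat_of_nonneg (hU e he))
  have hVcast (e) (he : exponentPoint e ∈ Δ) : ((V e).toNat : ℝ) = V e := by
    exact_mod_cast congrArg (Int.cast : ℤ → ℝ) (Int.toNat_of_nonneg (hV e he))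
  have hUmax (e) (he : exponentPoint e ∈ Δ) : U e ≤ U e₂ := by
    have := hmax _ he
    simp only [exponentPoint] at this
    rify [U]
    linarith
  have hwidth : latticeWidth u Δ = ((U e₂).toNat : ℝ) := by
    rw [hUcast _ he₂]
    refine IsGreatest.unique (isGreatest_latticeWidth hcomp ⟨_, he₁⟩ u)
      ⟨⟨_, he₂, _, he₁, ?_⟩, ?_⟩
    · simp only [U, exponentPoint]
      push_cast
      ring
    · rintro _ ⟨x, hx, y, hy, rfl⟩
      have hx' := hmax x hx
      have hy' := hmin y hy
      simp only [U]
      push_cast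
      linarith
  let φ : (Fin 2 →₀ ℕ) → ℕ × ℕ := fun e => ((U e).toNat, (V e).toNat)
  have hφ {e e'} (he : exponentPoint e ∈ Δ) (he' : exponentPoint e' ∈ Δ) (h : φ e = φ e') :
      e = e' := by
    have h1 : U e = U e' := by
      rw [← Int.toNat_of_nonneg (hU e he), ← Int.toNat_of_nonneg (hU e' he')]
      exact congrArg Nat.cast (congrArg Prod.fst h)
    have h2 : V e = V e' := by
      rw [← Int.toNat_of_nonneg (hV e he), ← Int.toNat_of_nonneg (hV e' he')]
      exact congrArg Nat.cast (congrArg Prod.snd h)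
    simp only [U, V] at h1 h2
    have h3 : (e 0 : ℤ) = e' 0 := by
      linear_combination v.2 * h1 - u.2 * h2 - (e 0 - e' 0 : ℤ) * huv
    have h4 : (e 1 : ℤ) = e' 1 := by
      linear_combination u.1 * h2 - v.1 * h1 - (e 1 - e' 1 : ℤ) * huv
    ext k
    fin_cases k
    · exact_mod_cast h3
    · exact_mod_cast h4
  have hfin := finite_exponents_of_isCompact hcomp
  let E := {e : Fin 2 →₀ ℕ // exponentPoint e ∈ Δ}
  have : Fintype E := hfin.fintype
  have : Infinite {x : F // x ≠ 0} := (Set.finite_singleton 0).infinite_compl.to_subtype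
  have : Infinite Fˣ := .of_injective _ unitsEquivNeZero.symm.injective
  obtain ⟨η, hη⟩ : ∃ η : Fin n → Fˣ, Function.Injective η :=
    ⟨_, (Infinite.natEmbedding Fˣ).injective.comp Fin.val_injective⟩
  let M : Fin n × Fin m × Fin m → E → Polynomial F := fun k e =>
    if (k.2.1 : ℕ) + k.2.2 < m then
      Polynomial.C (((φ e).1.choose k.2.1 : F) * ((φ e).2.choose k.2.2 * (η k.1 : F) ^ (φ e).2)) *
        Polynomial.X ^ ((k.1 : ℕ) * (φ e).1) else 0
  obtain ⟨a, ⟨el, hel, hael⟩, ⟨er, her, haer⟩, ha⟩ := exists_polynomial_solution_pair M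
    (fun e => (φ e).1 = 0) (fun e => (φ e).1 = (U e₂).toNat) (by
      intro τ hτ
      let ξ : Fˣ := Units.mk0 τ hτ
      obtain ⟨f, hf, hfΔ, hmult⟩ := hcurve fun k =>
        ((((ξ ^ (k : ℕ)) ^ u.1 * η k ^ v.1 : Fˣ) : F), (((ξ ^ (k : ℕ)) ^ u.2 * η k ^ v.2 : Fˣ) : F))
      have hsupp (e) (he : e ∈ f.support) : exponentPoint e ∈ Δ :=
        hfΔ ▸ exponentPoint_mem_newtonPolygon he
      refine ⟨fun e => coeff e.1 f, ?_, ?_, fun k => ?_⟩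
      · obtain ⟨e, he, hle⟩ := exists_mem_support_le hf (-u.1 : ℝ) (-u.2)
        refine ⟨⟨e, hsupp e he⟩, ?_, mem_support_iff.1 he⟩
        have h1 := hle _ (hfΔ ▸ he₁)
        simp only [exponentPoint] at h1
        refine Int.toNat_eq_zero.2 ?_
        rify [U]
        linarith
      · obtain ⟨e, he, hle⟩ := exists_mem_support_le hf (u.1 : ℝ) u.2
        refine ⟨⟨e, hsupp e he⟩, ?_, mem_support_iff.1 he⟩
        have h1 := hle _ (hfΔ ▸ he₂)
        simp only [exponentPoint] at h1
        refine congrArg Int.toNat (le_antisymm (hUmax _ (hsupp e he)) ?_)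
        rify [U]
        linarith
      · by_cases hk : (k.2.1 : ℕ) + k.2.2 < m
        · have h1 := sum_coeff_eq_zero_of_multAtLeast _ _ (hmult k.1)
            (A := -(u.1 * e₁ 0 + u.2 * e₁ 1)) (B := -(v.1 * e₃ 0 + v.2 * e₃ 1))
            (i := fun e => (φ e).1) (j := fun e => (φ e).2)
            (fun e he => Int.toNat_of_nonneg (hU e (hsupp e he)))
            (fun e he => Int.toNat_of_nonneg (hV e (hsupp e he))) hk
          rw [Finset.sum_subset (s₂ := hfin.toFinset) (fun e he => hfin.mem_toFinset.2 (hsupp e he))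
            (fun e _ he => by rw [notMem_support_iff.1 he, zero_mul]),
            Finset.sum_subtype _ (p := fun e => exponentPoint e ∈ Δ) fun _ => hfin.mem_toFinset]
            at h1
          rw [← h1]
          refine Finset.sum_congr rfl fun e _ => ?_
          simp [M, hk, ξ, pow_mul]
        · simp [M, hk])
  let E' : Finset (ℕ × ℕ) := (Finset.univ.filter fun e : E => a e ≠ 0).image fun e : E => φ e.1
  have hinj : Function.Injective fun e : E => φ e := fun e e' h => Subtype.ext (hφ e.2 e'.2 h)
  let b : ℕ × ℕ → Polynomial F := Function.extend (fun e : E => φ e) a 0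
  have hb (e : E) : b (φ e) = a e := hinj.extend_apply _ _ e
  have hE' {q} (hq : q ∈ E') : ∃ e : E, a e ≠ 0 ∧ φ e = q := by
    simpa [E'] using hq
  obtain ⟨D, hvol, hDconv, hDm, hD⟩ := volume_image_unimodular huv
    (-(u.1 * e₁ 0 + u.2 * e₁ 1)) (-(v.1 * e₃ 0 + v.2 * e₃ 1)) hcomp hconv
  have hcore := le_volume_of_multiplicity (m := m) E' b (η := fun k => (η k : F))
    (l := 0) (r := (U e₂).toNat)
    (fun q hq => by obtain ⟨e, he, rfl⟩ := hE' hq; rwa [hb])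
    (Units.val_injective.comp hη) (fun k => (η k).ne_zero)
    (fun k α β hαβ => by
      have h1 := ha (k, ⟨α, by omega⟩, ⟨β, by omega⟩)
      simp only [M, hαβ, if_true] at h1
      rw [Finset.sum_image fun e _ e' _ h => hinj h]
      refine ((Finset.sum_subset (Finset.filter_subset _ _) fun e _ he => ?_).trans
        (Finset.sum_congr rfl fun e _ => by rw [hb])).trans h1
      rw [Finset.mem_filter_univ, not_not] at he
      rw [hb, he, zero_mul])
    ⟨φ el, Finset.mem_image_of_mem _ (by simp [hael]), hel⟩
    ⟨φ er, Finset.mem_image_of_mem _ (by simp [haer]), her⟩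
    (fun q hq => by
      obtain ⟨e, -, rfl⟩ := hE' hq
      exact ⟨Nat.zero_le _, Int.toNat_le_toNat (hUmax _ e.2)⟩)
    (by rw [hwidth] at hω; exact_mod_cast hω) hDconv hDm
    (fun q hq => by
      obtain ⟨e, -, rfl⟩ := hE' hq
      have h1 := hD _ e.2
      convert h1 using 2
      · rw [hUcast _ e.2]
        simp [U, exponentPoint, sub_eq_add_neg]
      · rw [hVcast _ e.2]
        simp [V, exponentPoint, sub_eq_add_neg])
  rw [← hvol, hwidth]
  simpa using hcore

theorem exists_primitive_multiple {u : ℤ × ℤ} (hu : u ≠ 0) :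
    ∃ (g : ℕ) (u' v : ℤ × ℤ), 0 < g ∧ u = (u'.1 * g, u'.2 * g) ∧
      u'.1 * v.2 - u'.2 * v.1 = 1 := by
  have hgcd : 0 < Int.gcd u.1 u.2 := by
    rw [Int.gcd_pos_iff]
    by_contra! h
    exact hu (Prod.ext h.1 h.2)
  obtain ⟨g, a, b, hg, hab, h1, h2⟩ := Int.exists_gcd_one' hgcd
  obtain ⟨s, t, hst⟩ := Int.isCoprime_iff_gcd_eq_one.2 hab
  exact ⟨g, (a, b), (-t, s), hg, Prod.ext h1 h2, by linear_combination hst⟩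

/-- Equal multiplicities case: under the same hypotheses with
`m₁ = … = mₙ = m ≤ ω(Δ)`, one gets `area(Δ) ≥ ½·(n − ω(Δ)/m − 1)·m²`. -/
theorem statement1 (F : Type*) [Field F] [Infinite F]
    (n : ℕ) (hn : 1 ≤ n) (m : ℕ) (hm : 1 ≤ m)
    (Δ : Set (ℝ × ℝ)) (hΔ : IsLatticePolygon Δ)
    (hω : (m : ℝ) ≤ minLatticeWidth Δ)
    (hcurve : ∀ p : Fin n → F × F, ∃ Cf : MvPolynomial (Fin 2) F,
      Cf ≠ 0 ∧ newtonPolygon Cf = Δ ∧ ∀ i, multAtLeast (p i) m Cf) :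
    (MeasureTheory.volume Δ).toReal ≥
      (1 / 2) * ((n : ℝ) - minLatticeWidth Δ / (m : ℝ) - 1) * (m : ℝ) ^ 2 := by
  obtain ⟨f₀, hf₀, hΔ₀, -⟩ := hcurve fun _ => 0
  have hcomp : IsCompact Δ := hΔ₀ ▸ isCompact_newtonPolygon f₀
  have hne : Δ.Nonempty := hΔ.2.mono interior_subset
  have hm0 : (0 : ℝ) < m := by exact_mod_cast hm
  have hwidth (u : ℤ × ℤ) (hu : u ≠ 0) : (m : ℝ) ≤ latticeWidth u Δ :=
    hω.trans (csInf_le ⟨0, by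
      rintro _ ⟨u, -, rfl⟩
      exact latticeWidth_nonneg hcomp hne u⟩ ⟨u, hu, rfl⟩)
  have hfin : MeasureTheory.volume Δ ≠ ⊤ := hcomp.measure_lt_top.ne
  have hmin : (n * (m : ℝ) ^ 2 - 2 * (MeasureTheory.volume Δ).toReal) / m ≤ minLatticeWidth Δ := by
    refine le_csInf ⟨_, (1, 0), by simp, rfl⟩ ?_
    rintro _ ⟨u, hu, rfl⟩
    obtain ⟨g, u', v, hg, rfl, huv⟩ := exists_primitive_multiple hu
    refine le_trans ?_ (latticeWidth_le_of_mul hcomp hne u' hg)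
    have hu' : u' ≠ 0 := by
      rintro rfl
      simp at huv
    have h := (ENNReal.ofReal_le_iff_le_toReal hfin).1
      (le_volume_of_det_eq_one huv (hwidth u' hu') hcurve)
    rw [div_le_iff₀ hm0]
    linarith
  rw [div_le_iff₀ hm0] at hmin
  have h : (1 / 2) * ((n : ℝ) - minLatticeWidth Δ / (m : ℝ) - 1) * (m : ℝ) ^ 2 =
      (n * (m : ℝ) ^ 2 - minLatticeWidth Δ * m - (m : ℝ) ^ 2) / 2 := by
    field_simp
  rw [h]
  nlinarith [sq_nonneg (m : ℝ)]
end
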